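/- arXiv:1807.07225 — 7 statements merged into one kernel-verified Lean document; each statement's English description precedes it below -/
import Mathlib

section
/- Let λ, μ ∈ ℝ and s > 0. Let x ∈ ℝ² be such that z = x₁ + i·x₂ ∉ ℝ_{≤0}, and set ν = −x/|x|. Then the boundary traction of the function v(x) = (exp(−s√z), i·exp(−s√z)) satisfies T_ν v(x) = s·μ·(√z/|z|)·v(x); in particular the λ-dependent term and the curl term in the traction vanish for v. -/
noncomputable section

open Complex Set

/-- Principal complex square root. -/
def csqrt (z : ℂ) : ℂ := z ^ (1/2 : ℂ)

/-- Partial derivative in the first real coordinate. -/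
def pd1 (f : ℝ × ℝ → ℂ) (x : ℝ × ℝ) : ℂ := deriv (fun t => f (t, x.2)) x.1

/-- Partial derivative in the second real coordinate. -/
def pd2 (f : ℝ × ℝ → ℂ) (x : ℝ × ℝ) : ℂ := deriv (fun t => f (x.1, t)) x.2

/-- The exponential solution v(x) = (exp(−s√z), i exp(−s√z)), z = x₁ + i x₂. -/
def vfun (s : ℝ) (x : ℝ × ℝ) : ℂ × ℂ :=
  (Complex.exp (-(s : ℂ) * csqrt (x.1 + x.2 * Complex.I)),
   Complex.I * Complex.exp (-(s : ℂ) * csqrt (x.1 + x.2 * Complex.I)))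

/-- The planar boundary traction operator
`T_ν u = 2μ(ν₁∂₁u + ν₂∂₂u) + λν(∂₁u₁ + ∂₂u₂) + μν^⊥(∂₂u₁ − ∂₁u₂)`, `ν^⊥ = (−ν₂, ν₁)`. -/
def traction (lam mu : ℝ) (ν : ℝ × ℝ) (u : ℝ × ℝ → ℂ × ℂ) (x : ℝ × ℝ) : ℂ × ℂ :=
  (2 * (mu : ℂ) * ((ν.1 : ℂ) * pd1 (fun y => (u y).1) x + (ν.2 : ℂ) * pd2 (fun y => (u y).1) x)
      + (lam : ℂ) * (ν.1 : ℂ) * (pd1 (fun y => (u y).1) x + pd2 (fun y => (u y).2) x)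
      + (mu : ℂ) * (-(ν.2 : ℂ)) * (pd2 (fun y => (u y).1) x - pd1 (fun y => (u y).2) x),
   2 * (mu : ℂ) * ((ν.1 : ℂ) * pd1 (fun y => (u y).2) x + (ν.2 : ℂ) * pd2 (fun y => (u y).2) x)
      + (lam : ℂ) * (ν.2 : ℂ) * (pd1 (fun y => (u y).1) x + pd2 (fun y => (u y).2) x)
      + (mu : ℂ) * (ν.1 : ℂ) * (pd2 (fun y => (u y).1) x - pd1 (fun y => (u y).2) x))

theorem vexp_hasDerivAt (s : ℝ) (z : ℂ) (hz : z ∈ Complex.slitPlane) :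
    HasDerivAt (fun w : ℂ => Complex.exp (-(s : ℂ) * csqrt w))
      (Complex.exp (-(s : ℂ) * csqrt z) * (-(s : ℂ) * (csqrt z / (2 * z)))) z := by
  have hz0 : z ≠ 0 := Complex.slitPlane_ne_zero hz
  have h1 : HasDerivAt csqrt (csqrt z / (2 * z)) z := by
    have h := (hasDerivAt_id z).cpow_const (c := (1/2 : ℂ)) hz
    have e : (1/2 : ℂ) * id z ^ ((1/2 : ℂ) - 1) * 1 = csqrt z / (2 * z) := by
      unfold csqrt
      rw [Complex.cpow_sub _ _ (by simpa using hz0)]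
      simp only [id, Complex.cpow_one]
      field_simp
    rw [e] at h
    exact h
  exact (h1.const_mul (-(s : ℂ))).cexp

theorem stmt_3 (lam mu s : ℝ) (hs : 0 < s) (x : ℝ × ℝ)
    (hz : ¬((x.1 + x.2 * Complex.I).im = 0 ∧ (x.1 + x.2 * Complex.I).re ≤ 0)) :
    traction lam mu
        (-x.1 / ‖(x.1 + x.2 * Complex.I : ℂ)‖,
         -x.2 / ‖(x.1 + x.2 * Complex.I : ℂ)‖) (vfun s) x
      = ((s : ℂ) * (mu : ℂ) *
          (csqrt (x.1 + x.2 * Complex.I) / (‖(x.1 + x.2 * Complex.I : ℂ)‖ : ℂ)))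
          • vfun s x
    ∧ pd1 (fun y => (vfun s y).1) x + pd2 (fun y => (vfun s y).2) x = 0
    ∧ pd2 (fun y => (vfun s y).1) x - pd1 (fun y => (vfun s y).2) x = 0 := by
  set z : ℂ := (x.1 + x.2 * Complex.I : ℂ) with hzdef
  have hslit : z ∈ Complex.slitPlane := by
    rw [Complex.mem_slitPlane_iff]
    by_contra hcon
    push Not at hcon
    exact hz ⟨hcon.2, hcon.1⟩
  have hz0 : z ≠ 0 := Complex.slitPlane_ne_zero hslit
  have hn : ((‖z‖ : ℝ) : ℂ) ≠ 0 := by simpa using hz0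
  have hE := vexp_hasDerivAt s z hslit
  set D : ℂ := Complex.exp (-(s : ℂ) * csqrt z) * (-(s : ℂ) * (csqrt z / (2 * z))) with hD
  have g1 : HasDerivAt (fun t : ℝ => (t : ℂ) + (x.2 : ℂ) * Complex.I) 1 x.1 :=
    (Complex.ofRealCLM.hasDerivAt (x := x.1)).add_const _
  have g2 : HasDerivAt (fun t : ℝ => (x.1 : ℂ) + (t : ℂ) * Complex.I) Complex.I x.2 := by
    have h := ((Complex.ofRealCLM.hasDerivAt (x := x.2)).mul_const Complex.I).const_add (x.1 : ℂ)
    simpa using h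
  have k1 : HasDerivAt (fun t : ℝ => Complex.exp (-(s : ℂ) * csqrt ((t : ℂ) + (x.2 : ℂ) * Complex.I)))
      (D * 1) x.1 := HasDerivAt.comp x.1 (h₂ := fun w : ℂ => Complex.exp (-(s : ℂ) * csqrt w)) hE g1
  have k2 : HasDerivAt (fun t : ℝ => Complex.exp (-(s : ℂ) * csqrt ((x.1 : ℂ) + (t : ℂ) * Complex.I)))
      (D * Complex.I) x.2 :=
    HasDerivAt.comp x.2 (h₂ := fun w : ℂ => Complex.exp (-(s : ℂ) * csqrt w)) hE g2
  have p11 : pd1 (fun y => (vfun s y).1) x = D := by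
    rw [← mul_one D]; exact k1.deriv
  have p21 : pd2 (fun y => (vfun s y).1) x = D * Complex.I := k2.deriv
  have p12 : pd1 (fun y => (vfun s y).2) x = Complex.I * D := by
    rw [← mul_one D]; exact (k1.const_mul Complex.I).deriv
  have p22 : pd2 (fun y => (vfun s y).2) x = -D := by
    have h : pd2 (fun y => (vfun s y).2) x = Complex.I * (D * Complex.I) :=
      (k2.const_mul Complex.I).deriv
    rw [h]; linear_combination D * Complex.I_mul_I
  have key : z * D = -(s : ℂ) / 2 * csqrt z * Complex.exp (-(s : ℂ) * csqrt z) := by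
    rw [hD]; field_simp
  refine ⟨?_, by rw [p11, p22]; ring, by rw [p21, p12]; ring⟩
  have hv : vfun s x = (Complex.exp (-(s : ℂ) * csqrt z),
      Complex.I * Complex.exp (-(s : ℂ) * csqrt z)) := rfl
  unfold traction
  rw [p11, p21, p12, p22, hv]
  clear_value D
  ext1
  · simp only [Prod.smul_mk, smul_eq_mul]
    push_cast
    have : (2 : ℂ) * mu * (-x.1 / ‖z‖ * D + -x.2 / ‖z‖ * (D * Complex.I))
        = -2 * mu / ‖z‖ * (z * D) := by rw [hzdef]; ring
    rw [this, key]; ring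
  · simp only [Prod.smul_mk, smul_eq_mul]
    push_cast
    have : (2 : ℂ) * mu * (-x.1 / ‖z‖ * (Complex.I * D) + -x.2 / ‖z‖ * -D)
        = -2 * mu / ‖z‖ * Complex.I * (z * D) := by
      rw [hzdef]; linear_combination (2 * mu / ‖z‖ * x.2 * D) * Complex.I_mul_I
    rw [this, key]; ring
end
end

section
/- Let −π < θ_m < θ_M < π, s > 0 and α > 0, let K be the open planar sector with angles θ_m, θ_M, and set δ_K = min_{θ_m ≤ θ ≤ θ_M} cos(θ/2) > 0. Then ∫_K |exp(−s√(x₁ + i·x₂))|·|x|^α dx ≤ 2(θ_M − θ_m)·Γ(2α+4)·δ_K^{−(2α+4)}·s^{−(2α+4)}, where Γ is the Gamma function. -/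
noncomputable section

open Complex MeasureTheory Real Set

/-- The open planar sector with angles `θm < arg z < θM`. -/
def sector (θm θM : ℝ) : Set (ℝ × ℝ) :=
  {x | (x.1 + x.2 * Complex.I) ≠ 0 ∧ θm < (x.1 + x.2 * Complex.I).arg ∧
        (x.1 + x.2 * Complex.I).arg < θM}

/-- `δ_K = min_{θm ≤ θ ≤ θM} cos(θ/2)`. -/
def deltaK (θm θM : ℝ) : ℝ := sInf ((fun θ => Real.cos (θ / 2)) '' Set.Icc θm θM)

theorem re_csqrt (z : ℂ) (hz : z ≠ 0) :
    (csqrt z).re = ‖z‖ ^ (1/2 : ℝ) * Real.cos (z.arg / 2) := by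
  have hn : 0 < ‖z‖ := norm_pos_iff.mpr hz
  have hre : (Complex.log z * (1/2 : ℂ)).re = Real.log ‖z‖ * (1/2) := by
    rw [show (1/2 : ℂ) = ((1/2 : ℝ) : ℂ) by norm_num, Complex.re_mul_ofReal, Complex.log_re]
  have him : (Complex.log z * (1/2 : ℂ)).im = z.arg / 2 := by
    rw [show (1/2 : ℂ) = ((1/2 : ℝ) : ℂ) by norm_num, Complex.im_mul_ofReal, Complex.log_im]
    ring
  rw [csqrt, Complex.cpow_def_of_ne_zero hz, Complex.exp_re, hre, him,
    Real.rpow_def_of_pos hn]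

theorem deltaK_spec (θm θM : ℝ) (h1 : -π < θm) (h2 : θm < θM) (h3 : θM < π) :
    0 < deltaK θm θM ∧ ∀ θ ∈ Set.Icc θm θM, deltaK θm θM ≤ Real.cos (θ / 2) := by
  have hc : IsCompact ((fun θ => Real.cos (θ / 2)) '' Set.Icc θm θM) :=
    isCompact_Icc.image (by fun_prop)
  have hne : ((fun θ => Real.cos (θ / 2)) '' Set.Icc θm θM).Nonempty :=
    (Set.nonempty_Icc.mpr h2.le).image _
  constructor
  · obtain ⟨θ, hθ, he⟩ := hc.sInf_mem hne
    rw [deltaK, ← he]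
    exact Real.cos_pos_of_mem_Ioo ⟨by linarith [hθ.1], by linarith [hθ.2]⟩
  · intro θ hθ
    exact csInf_le hc.bddBelow ⟨θ, hθ, rfl⟩

theorem sector_meas (θm θM : ℝ) : MeasurableSet (sector θm θM) := by
  have hm : Measurable (fun x : ℝ × ℝ => (x.1 + x.2 * Complex.I : ℂ)) := by fun_prop
  have ha := Complex.measurable_arg.comp hm
  exact ((measurableSet_singleton (0:ℂ)).compl.preimage hm).inter
    ((measurableSet_lt measurable_const ha).inter (measurableSet_lt ha measurable_const))

theorem radial (α b : ℝ) (hα : 0 < α) (hb : 0 < b) :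
    ∫⁻ r in Ioi (0:ℝ), ENNReal.ofReal (r ^ (α + 1) * Real.exp (-b * r ^ (1/2 : ℝ))) =
      ENNReal.ofReal (2 * Real.Gamma (2 * α + 4) * b ^ (-(2 * α + 4))) := by
  rw [← ofReal_integral_eq_lintegral_ofReal
    (integrableOn_rpow_mul_exp_neg_mul_rpow (by linarith) (by norm_num) hb)]
  · rw [_root_.integral_rpow_mul_exp_neg_mul_rpow (by norm_num) (by linarith) hb]
    congr 1
    rw [show -(α + 1 + 1) / (1/2 : ℝ) = -(2 * α + 4) by ring,
      show (α + 1 + 1) / (1/2 : ℝ) = 2 * α + 4 by ring]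
    ring
  · filter_upwards [ae_restrict_mem measurableSet_Ioi] with r hr
    have : (0:ℝ) < r := hr
    show (0:ℝ) ≤ _
    positivity


theorem stmt_5 (θm θM s α : ℝ) (h1 : -π < θm) (h2 : θm < θM) (h3 : θM < π)
    (hs : 0 < s) (hα : 0 < α) :
    0 < deltaK θm θM ∧
      ∫⁻ x in sector θm θM,
          ENNReal.ofReal
            (‖Complex.exp (-(s : ℂ) * csqrt (x.1 + x.2 * Complex.I))‖ *
              ‖(x.1 + x.2 * Complex.I : ℂ)‖ ^ α)
        ≤ ENNReal.ofReal
            (2 * (θM - θm) * Real.Gamma (2 * α + 4) *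
              deltaK θm θM ^ (-(2 * α + 4)) * s ^ (-(2 * α + 4))) := by
  obtain ⟨hδ, hle⟩ := deltaK_spec θm θM h1 h2 h3
  refine ⟨hδ, ?_⟩
  set δ := deltaK θm θM with hδdef
  have hb : 0 < s * δ := mul_pos hs hδ
  rw [← lintegral_indicator (sector_meas θm θM), ← lintegral_comp_polarCoord_symm]
  set g : ℝ × ℝ → ENNReal := fun p =>
    ENNReal.ofReal (p.1 ^ (α + 1) * Real.exp (-(s * δ) * p.1 ^ (1/2 : ℝ))) with hg
  have hS : MeasurableSet (Ioi (0:ℝ) ×ˢ Ioo θm θM) := measurableSet_Ioi.prod measurableSet_Ioo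
  have hgm : Measurable g := by
    rw [hg]; fun_prop
  calc _ ≤ ∫⁻ p in polarCoord.target, (Ioi (0:ℝ) ×ˢ Ioo θm θM).indicator g p := by
        apply setLIntegral_mono (hgm.indicator hS)
        rintro ⟨r, θ⟩ hp
        rw [polarCoord_target] at hp
        obtain ⟨hr, hθ⟩ := hp
        have hr : 0 < r := hr
        have hθ : θ ∈ Ioo (-π) π := hθ
        have hz : (((polarCoord.symm (r, θ)).1 : ℂ) + ((polarCoord.symm (r, θ)).2 : ℂ) * Complex.I)
            = r * (Complex.cos θ + Complex.sin θ * Complex.I) := by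
          simp [polarCoord_symm_apply]; ring
        have harg : (r * (Complex.cos θ + Complex.sin θ * Complex.I) : ℂ).arg = θ :=
          Complex.arg_mul_cos_add_sin_mul_I hr ⟨hθ.1, hθ.2.le⟩
        have hnorm : ‖(r * (Complex.cos θ + Complex.sin θ * Complex.I) : ℂ)‖ = r := by
          rw [norm_mul, Complex.norm_cos_add_sin_mul_I, mul_one, Complex.norm_real,
            Real.norm_of_nonneg hr.le]
        by_cases hmem : polarCoord.symm (r, θ) ∈ sector θm θM
        · rw [indicator_of_mem hmem]
          have hmem' := hmem
          simp only [sector, mem_ofPred_eq] at hmem'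
          rw [hz, harg] at hmem'
          obtain ⟨hz0, ha, hb'⟩ := hmem'
          rw [indicator_of_mem (show (r, θ) ∈ Ioi (0:ℝ) ×ˢ Ioo θm θM from ⟨hr, ha, hb'⟩)]
          simp only [hg]
          rw [hz, hnorm, smul_eq_mul, ← ENNReal.ofReal_mul hr.le]
          apply ENNReal.ofReal_le_ofReal
          rw [Complex.norm_exp, ← Complex.ofReal_neg, Complex.re_ofReal_mul, re_csqrt _ hz0,
            hnorm, harg, Real.rpow_add hr, Real.rpow_one]
          have hc := hle θ ⟨ha.le, hb'.le⟩
          have : Real.exp (-s * (r ^ (1/2:ℝ) * Real.cos (θ / 2))) ≤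
              Real.exp (-(s * δ) * r ^ (1/2:ℝ)) := by
            apply Real.exp_le_exp.mpr
            have : 0 ≤ s * r ^ (1/2:ℝ) := by positivity
            nlinarith [mul_le_mul_of_nonneg_left hc this]
          calc _ = r ^ α * r * Real.exp (-s * (r ^ (1/2:ℝ) * Real.cos (θ / 2))) := by ring
            _ ≤ _ := by gcongr
        · rw [indicator_of_notMem hmem]
          simp
    _ ≤ ∫⁻ p, (Ioi (0:ℝ) ×ˢ Ioo θm θM).indicator g p := setLIntegral_le_lintegral _ _
    _ = ∫⁻ p in Ioi (0:ℝ) ×ˢ Ioo θm θM, g p := lintegral_indicator hS _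
    _ = ∫⁻ r in Ioi (0:ℝ), ∫⁻ _ in Ioo θm θM,
          ENNReal.ofReal (r ^ (α + 1) * Real.exp (-(s * δ) * r ^ (1/2 : ℝ))) := by
        rw [Measure.volume_eq_prod, ← Measure.prod_restrict, lintegral_prod _ hgm.aemeasurable]
    _ = ENNReal.ofReal (2 * Real.Gamma (2 * α + 4) * (s * δ) ^ (-(2 * α + 4))) *
          ENNReal.ofReal (θM - θm) := by
        simp_rw [setLIntegral_const, Real.volume_Ioo]
        rw [lintegral_mul_const' _ _ ENNReal.ofReal_ne_top, radial α _ hα hb]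
    _ ≤ _ := by
        rw [← ENNReal.ofReal_mul' (by linarith), Real.mul_rpow hs.le hδ.le]
        apply le_of_eq
        congr 1
        ring
end
end

section
/- Let −π < θ_m < θ_M < π, h > 0, α ∈ (0,1), and let K be the open planar sector with angles θ_m, θ_M and B = B(0,h). Let f : ℝ² → ℂ² be α-Hölder continuous on the closure of K ∩ B. Then, with v_s(x) = (exp(−s√z), i·exp(−s√z)) and the bilinear dot product, lim_{s→∞} s⁴·∫_{K∩B} v_s(x)·f(x) dx = 6i·(e^{−2iθ_M} − e^{−2iθ_m})·(f₁(0) + i·f₂(0)). -/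
noncomputable section

open Complex MeasureTheory Real Set Filter

/-- The open (Euclidean) disc of radius `h` centred at the origin of the plane. -/
def disc (h : ℝ) : Set (ℝ × ℝ) := {x | ‖(x.1 + x.2 * Complex.I : ℂ)‖ < h}

/-- The bilinear (non-conjugated) dot product on ℂ². -/
def cdot (a b : ℂ × ℂ) : ℂ := a.1 * b.1 + a.2 * b.2

theorem aux_z (r θ : ℝ) : ((r * Real.cos θ : ℝ) : ℂ) + ((r * Real.sin θ : ℝ) : ℂ) * Complex.I
    = (r : ℂ) * (Complex.cos θ + Complex.sin θ * Complex.I) := by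
  push_cast; ring

theorem aux_arg (r θ : ℝ) (hr : 0 < r) (hθ : θ ∈ Ioo (-π) π) :
    (((r * Real.cos θ : ℝ) : ℂ) + ((r * Real.sin θ : ℝ) : ℂ) * Complex.I).arg = θ := by
  rw [aux_z]
  exact Complex.arg_mul_cos_add_sin_mul_I hr ⟨hθ.1, hθ.2.le⟩

theorem aux_norm (r θ : ℝ) (hr : 0 < r) :
    ‖(((r * Real.cos θ : ℝ) : ℂ) + ((r * Real.sin θ : ℝ) : ℂ) * Complex.I)‖ = r := by
  rw [aux_z, norm_mul, Complex.norm_cos_add_sin_mul_I, Complex.norm_of_nonneg hr.le, mul_one]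

theorem aux_csqrt (r θ : ℝ) (hr : 0 < r) (hθ : θ ∈ Ioo (-π) π) :
    csqrt (((r * Real.cos θ : ℝ) : ℂ) + ((r * Real.sin θ : ℝ) : ℂ) * Complex.I)
      = (Real.sqrt r : ℂ) * Complex.exp ((θ / 2 : ℝ) * Complex.I) := by
  have hn := aux_norm r θ hr
  have ha := aux_arg r θ hr hθ
  set z := (((r * Real.cos θ : ℝ) : ℂ) + ((r * Real.sin θ : ℝ) : ℂ) * Complex.I) with hz
  have hz0 : z ≠ 0 := by
    intro h; rw [h, norm_zero] at hn; linarith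
  unfold csqrt
  rw [Complex.cpow_def_of_ne_zero hz0, Complex.log, hn, ha, add_mul, Complex.exp_add]
  congr 1
  · rw [Real.sqrt_eq_rpow, Real.rpow_def_of_pos hr]
    push_cast; ring_nf
  · push_cast; ring_nf

theorem aux_lim (w : ℂ) (hw : 0 < w.re) (k : ℕ) :
    Tendsto (fun t : ℝ => (t : ℂ) ^ k * Complex.exp (-(w * t))) atTop (nhds 0) := by
  rw [tendsto_zero_iff_norm_tendsto_zero]
  have := tendsto_rpow_mul_exp_neg_mul_atTop_nhds_zero k w.re hw
  refine this.congr' ?_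
  filter_upwards [eventually_gt_atTop 0] with t ht
  rw [norm_mul, norm_pow, Complex.norm_exp, Complex.norm_of_nonneg ht.le, Real.rpow_natCast]
  simp

theorem aux_cube (w : ℂ) (hw : 0 < w.re) :
    ∫ t in Ioi (0 : ℝ), (t : ℂ) ^ 3 * Complex.exp (-(w * t)) = 6 / w ^ 4 := by
  have hw0 : w ≠ 0 := by
    rintro rfl; simp at hw
  set G : ℝ → ℂ := fun t => -((t : ℂ) ^ 3 * Complex.exp (-(w * t)) / w
    + 3 * ((t : ℂ) ^ 2 * Complex.exp (-(w * t))) / w ^ 2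
    + 6 * ((t : ℂ) ^ 1 * Complex.exp (-(w * t))) / w ^ 3
    + 6 * ((t : ℂ) ^ 0 * Complex.exp (-(w * t))) / w ^ 4) with hG
  have hd : ∀ t ∈ Ici (0 : ℝ), HasDerivAt G ((t : ℂ) ^ 3 * Complex.exp (-(w * t))) t := by
    intro t _
    have ho : HasDerivAt (fun t : ℝ => (t : ℂ)) 1 t := Complex.ofRealCLM.hasDerivAt
    have he : HasDerivAt (fun t : ℝ => Complex.exp (-(w * t)))
      (Complex.exp (-(w * t)) * (-(w * 1))) t := ((ho.const_mul w).neg).cexp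
    have := (((((ho.pow 3).mul he).div_const w).add
      ((((ho.pow 2).mul he).const_mul 3).div_const (w ^ 2))).add
      ((((ho.pow 1).mul he).const_mul 6).div_const (w ^ 3))).add
      ((((ho.pow 0).mul he).const_mul 6).div_const (w ^ 4)) |>.neg
    refine this.congr_deriv ?_
    push_cast
    simp
    field_simp
    ring
  have hl : Tendsto G atTop (nhds 0) := by
    have := ((((aux_lim w hw 3).div_const w).add
      (((aux_lim w hw 2).const_mul 3).div_const (w ^ 2))).add
      (((aux_lim w hw 1).const_mul 6).div_const (w ^ 3))).add
      (((aux_lim w hw 0).const_mul 6).div_const (w ^ 4)) |>.neg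
    simpa [hG] using this
  have hi : IntegrableOn (fun t : ℝ => (t : ℂ) ^ 3 * Complex.exp (-(w * t))) (Ioi 0) := by
    have := integrableOn_rpow_mul_exp_neg_mul_rpow (p := 1) (s := 3) (b := w.re)
      (by norm_num) (by norm_num) hw
    refine Integrable.mono' this (by fun_prop) ?_
    filter_upwards [ae_restrict_mem measurableSet_Ioi] with t ht
    have ht : 0 < t := ht
    rw [norm_mul, norm_pow, Complex.norm_exp, Complex.norm_of_nonneg ht.le]
    apply le_of_eq
    rw [show (3 : ℝ) = ((3 : ℕ) : ℝ) by norm_num, Real.rpow_natCast]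
    simp
  rw [integral_Ioi_of_hasDerivAt_of_tendsto' hd hi hl]
  simp [hG]

theorem aux_inner (w : ℂ) (hw : 0 < w.re) :
    ∫ r in Ioi (0 : ℝ), (r : ℂ) * Complex.exp (-((Real.sqrt r : ℂ) * w)) = 12 / w ^ 4 := by
  rw [← integral_comp_rpow_Ioi_of_pos (p := 2) two_pos]
  have h2 : ∫ x in Ioi (0 : ℝ), (2 * x ^ ((2 : ℝ) - 1)) • (((x ^ (2 : ℝ) : ℝ) : ℂ) *
      Complex.exp (-((Real.sqrt (x ^ (2 : ℝ)) : ℂ) * w)))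
      = ∫ t in Ioi (0 : ℝ), 2 * ((t : ℂ) ^ 3 * Complex.exp (-(w * t))) := by
    apply setIntegral_congr_fun measurableSet_Ioi
    intro x hx
    have hx : 0 < x := hx
    have e1 : x ^ ((2 : ℝ) - 1) = x := by norm_num
    have e2 : x ^ (2 : ℝ) = x ^ 2 := by norm_num
    simp only [e1, e2, Real.sqrt_sq hx.le, Complex.real_smul]
    push_cast
    rw [mul_comm w]; ring
  rw [h2, integral_const_mul, aux_cube w hw]
  ring

theorem aux_cos (θm θM : ℝ) (h1 : -π < θm) (h2 : θm < θM) (h3 : θM < π) :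
    ∃ c : ℝ, 0 < c ∧ ∀ θ ∈ Ioo θm θM, c ≤ Real.cos (θ / 2) := by
  set a := max |θm| |θM| with ha
  have hA : a < π := by
    apply max_lt <;> rw [abs_lt] <;> constructor <;> linarith
  refine ⟨Real.cos (a / 2), ?_, ?_⟩
  · apply Real.cos_pos_of_mem_Ioo
    have : 0 ≤ a := le_max_of_le_left (abs_nonneg _)
    constructor <;> linarith [Real.pi_pos]
  · intro θ hθ
    rw [← Real.cos_abs (θ / 2)]
    have : |θ| ≤ a := by
      rw [abs_le]
      have := neg_abs_le θm
      have := le_abs_self θM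
      have := le_max_left |θm| |θM|
      have := le_max_right |θm| |θM|
      constructor <;> linarith [hθ.1, hθ.2]
    apply Real.cos_le_cos_of_nonneg_of_le_pi (abs_nonneg _) (by linarith [Real.pi_pos])
    rw [abs_div, abs_two]; linarith

theorem aux_exp_norm (r θ : ℝ) :
    ‖Complex.exp (-((Real.sqrt r : ℂ) * Complex.exp ((θ / 2 : ℝ) * Complex.I)))‖
      = Real.exp (-(Real.sqrt r * Real.cos (θ / 2))) := by
  rw [Complex.norm_exp, Complex.neg_re, Complex.re_ofReal_mul, Complex.exp_ofReal_mul_I_re]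

theorem aux_bound_int (θm θM c M : ℝ) (hc : 0 < c) :
    Integrable (fun p : ℝ × ℝ => (p.1 * Real.exp (-(c * Real.sqrt p.1))) * M)
      (volume.restrict (Ioi (0 : ℝ) ×ˢ Ioo θm θM)) := by
  rw [Measure.volume_eq_prod, ← Measure.prod_restrict]
  have := integrableOn_rpow_mul_exp_neg_mul_rpow (p := 1/2) (s := 1) (b := c)
    (by norm_num) (by norm_num) hc
  simp only [Real.rpow_one, ← Real.sqrt_eq_rpow, neg_mul] at this
  exact Integrable.mul_prod (f := fun r : ℝ => r * Real.exp (-(c * Real.sqrt r)))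
    (g := fun _ : ℝ => M) this (integrable_const M)

theorem aux_outer (θm θM : ℝ) (h1 : -π < θm) (h2 : θm < θM) (h3 : θM < π) (A : ℂ) :
    ∫ p in Ioi (0 : ℝ) ×ˢ Ioo θm θM, p.1 •
      (Complex.exp (-((Real.sqrt p.1 : ℂ) * Complex.exp ((p.2 / 2 : ℝ) * Complex.I))) * A)
    = 6 * Complex.I *
        (Complex.exp (-2 * (θM : ℂ) * Complex.I) - Complex.exp (-2 * (θm : ℂ) * Complex.I)) * A := by
  obtain ⟨c, hc, hcos⟩ := aux_cos θm θM h1 h2 h3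
  have hint : Integrable (fun p : ℝ × ℝ => p.1 •
      (Complex.exp (-((Real.sqrt p.1 : ℂ) * Complex.exp ((p.2 / 2 : ℝ) * Complex.I))) * A))
      (volume.restrict (Ioi (0 : ℝ) ×ˢ Ioo θm θM)) := by
    refine (aux_bound_int θm θM c ‖A‖ hc).mono' (by fun_prop) ?_
    filter_upwards [ae_restrict_mem (measurableSet_Ioi.prod measurableSet_Ioo)] with p hp
    have hp1 : 0 < p.1 := hp.1
    rw [norm_smul, norm_mul, aux_exp_norm, Real.norm_of_nonneg hp1.le, mul_assoc]
    have := hcos p.2 hp.2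
    gcongr p.1 * (Real.exp (-?_) * _)
    rw [mul_comm c]
    gcongr
  rw [Measure.volume_eq_prod, ← Measure.prod_restrict] at hint ⊢
  rw [integral_prod_symm _ hint]
  have : ∫ θ in Ioo θm θM, ∫ r in Ioi (0 : ℝ), r •
      (Complex.exp (-((Real.sqrt r : ℂ) * Complex.exp ((θ / 2 : ℝ) * Complex.I))) * A)
      = ∫ θ in Ioo θm θM, Complex.exp ((-2 * Complex.I) * θ) * (12 * A) := by
    apply setIntegral_congr_fun measurableSet_Ioo
    intro θ hθ
    have := aux_inner (Complex.exp ((θ / 2 : ℝ) * Complex.I))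
      (by rw [Complex.exp_ofReal_mul_I_re]; exact lt_of_lt_of_le hc (hcos θ hθ))
    simp only [Complex.real_smul, ← mul_assoc]
    rw [integral_mul_const, this, ← Complex.exp_nat_mul, div_eq_mul_inv, ← Complex.exp_neg]
    push_cast
    ring_nf
  simp only
  rw [this, integral_mul_const, ← integral_Ioc_eq_integral_Ioo,
    ← intervalIntegral.integral_of_le h2.le, integral_exp_mul_complex (by simp)]
  rw [show -2 * Complex.I * (θM : ℂ) = -2 * (θM : ℂ) * Complex.I by ring,
    show -2 * Complex.I * (θm : ℂ) = -2 * (θm : ℂ) * Complex.I by ring]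
  have hI : (-2 * Complex.I)⁻¹ = Complex.I / 2 := by
    rw [mul_inv, Complex.inv_I]; ring
  rw [div_eq_mul_inv, hI]
  ring

theorem aux_meas (θm θM h : ℝ) : MeasurableSet (sector θm θM ∩ disc h) := by
  have hz : Measurable (fun x : ℝ × ℝ => (x.1 : ℂ) + x.2 * Complex.I) := by fun_prop
  have ha := Complex.measurable_arg.comp hz
  refine MeasurableSet.inter (MeasurableSet.inter ?_ (MeasurableSet.inter ?_ ?_)) ?_
  · exact (hz (measurableSet_singleton 0)).compl
  · exact measurableSet_lt measurable_const ha
  · exact measurableSet_lt ha measurable_const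
  · exact measurableSet_lt hz.norm measurable_const

theorem aux_mem (θm θM h r θ : ℝ) (hr : 0 < r) (hθ : θ ∈ Ioo (-π) π) :
    (r * Real.cos θ, r * Real.sin θ) ∈ sector θm θM ∩ disc h ↔ θ ∈ Ioo θm θM ∧ r < h := by
  have hn := aux_norm r θ hr
  have ha := aux_arg r θ hr hθ
  simp only [sector, disc, mem_inter_iff, Set.mem_ofPred_eq, ha, hn, mem_Ioo]
  have : ((r * Real.cos θ : ℝ) : ℂ) + ((r * Real.sin θ : ℝ) : ℂ) * Complex.I ≠ 0 := by
    intro h; rw [h, norm_zero] at hn; linarith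
  tauto

theorem aux_transform (θm θM h : ℝ) (h1 : -π < θm) (h3 : θM < π)
    (F : ℝ × ℝ → ℂ) (s : ℝ) (hs : 0 < s) :
    (s : ℂ) ^ 4 * ∫ x in sector θm θM ∩ disc h,
        Complex.exp (-(s : ℂ) * csqrt (x.1 + x.2 * Complex.I)) * F x
    = ∫ p in Ioi (0 : ℝ) ×ˢ Ioo θm θM, p.1 •
      (Complex.exp (-((Real.sqrt p.1 : ℂ) * Complex.exp ((p.2 / 2 : ℝ) * Complex.I))) *
        (sector θm θM ∩ disc h).indicator F
          ((s ^ 2)⁻¹ * p.1 * Real.cos p.2, (s ^ 2)⁻¹ * p.1 * Real.sin p.2)) := by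
  set S := sector θm θM ∩ disc h with hS
  have hSm : MeasurableSet S := aux_meas θm θM h
  set g : ℝ × ℝ → ℂ := fun x => Complex.exp (-(s : ℂ) * csqrt (x.1 + x.2 * Complex.I)) *
    S.indicator F x with hg
  have e0 : ∫ x in S, Complex.exp (-(s : ℂ) * csqrt (x.1 + x.2 * Complex.I)) * F x = ∫ x, g x := by
    rw [← integral_indicator hSm]
    congr 1
    ext x
    by_cases hx : x ∈ S <;> simp [hg, hx]
  have e1 : (s : ℂ) ^ 4 * ∫ x, g x = ∫ x, g ((s ^ 2)⁻¹ • x) := by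
    rw [Measure.integral_comp_smul]
    have : Module.finrank ℝ (ℝ × ℝ) = 2 := by simp
    rw [this, Complex.real_smul]
    congr 1
    rw [abs_of_nonneg (by positivity)]
    push_cast
    simp only [inv_pow, inv_inv]
    ring
  rw [e0, e1, ← integral_comp_polarCoord_symm]
  have hsub : Ioi (0 : ℝ) ×ˢ Ioo θm θM ⊆ polarCoord.target := by
    rintro ⟨r, θ⟩ ⟨hr, hθ⟩
    exact ⟨hr, lt_trans h1 hθ.1, lt_trans hθ.2 h3⟩
  have hg2 : ∀ p ∈ polarCoord.target, g ((s ^ 2)⁻¹ • polarCoord.symm p) =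
      Complex.exp (-((Real.sqrt p.1 : ℂ) * Complex.exp ((p.2 / 2 : ℝ) * Complex.I))) *
        S.indicator F ((s ^ 2)⁻¹ * p.1 * Real.cos p.2, (s ^ 2)⁻¹ * p.1 * Real.sin p.2) := by
    rintro ⟨r, θ⟩ ⟨hr, hθ⟩
    have hr : 0 < r := hr
    have hr' : 0 < (s ^ 2)⁻¹ * r := by positivity
    have ex : (s ^ 2)⁻¹ • polarCoord.symm (r, θ) =
      ((s ^ 2)⁻¹ * r * Real.cos θ, (s ^ 2)⁻¹ * r * Real.sin θ) := by
      simp [polarCoord_symm_apply, mul_assoc]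
    rw [ex]
    simp only [hg]
    rw [aux_csqrt _ θ hr' hθ]
    congr 2
    have : (Real.sqrt ((s ^ 2)⁻¹ * r)) = s⁻¹ * Real.sqrt r := by
      rw [Real.sqrt_mul (by positivity), Real.sqrt_inv, Real.sqrt_sq hs.le]
    rw [this]
    have : (s : ℂ) ≠ 0 := by exact_mod_cast hs.ne'
    push_cast
    field_simp
  have e2 : ∫ p in polarCoord.target, p.1 • g ((s ^ 2)⁻¹ • polarCoord.symm p) =
      ∫ p in Ioi (0 : ℝ) ×ˢ Ioo θm θM, p.1 • g ((s ^ 2)⁻¹ • polarCoord.symm p) := by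
    apply setIntegral_eq_of_subset_of_forall_sdiff_eq_zero
      polarCoord.open_target.measurableSet hsub
    intro p hp
    rw [hg2 p hp.1]
    obtain ⟨⟨hr, hθ⟩, hn⟩ := hp
    have hr : 0 < p.1 := hr
    have hr' : 0 < (s ^ 2)⁻¹ * p.1 := by positivity
    have : ((s ^ 2)⁻¹ * p.1 * Real.cos p.2, (s ^ 2)⁻¹ * p.1 * Real.sin p.2) ∉ S := by
      rw [hS, aux_mem _ _ _ _ _ hr' hθ]
      intro hc
      exact hn ⟨hr, hc.1⟩
    rw [indicator_of_notMem this]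
    simp
  rw [e2]
  apply setIntegral_congr_fun (measurableSet_Ioi.prod measurableSet_Ioo)
  intro p hp
  simp only
  rw [hg2 p (hsub hp)]

theorem stmt_9 (θm θM h α : ℝ) (h1 : -π < θm) (h2 : θm < θM) (h3 : θM < π)
    (hh : 0 < h) (hα : 0 < α) (hα' : α < 1) (f : ℝ × ℝ → ℂ × ℂ)
    (hf : ∃ C : ℝ, 0 ≤ C ∧ ∀ x ∈ closure (sector θm θM ∩ disc h),
      ∀ y ∈ closure (sector θm θM ∩ disc h),
        ‖f x - f y‖ ≤ C * Real.sqrt ((x.1 - y.1) ^ 2 + (x.2 - y.2) ^ 2) ^ α) :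
    Tendsto (fun s : ℝ => (s : ℂ) ^ 4 * ∫ x in sector θm θM ∩ disc h, cdot (vfun s x) (f x))
      atTop
      (nhds (6 * Complex.I *
        (Complex.exp (-2 * (θM : ℂ) * Complex.I) - Complex.exp (-2 * (θm : ℂ) * Complex.I)) *
        ((f (0, 0)).1 + Complex.I * (f (0, 0)).2))) := by
  obtain ⟨C, hC, hf⟩ := hf
  obtain ⟨c, hc, hcos⟩ := aux_cos θm θM h1 h2 h3
  set S := sector θm θM ∩ disc h with hS
  have hSm : MeasurableSet S := aux_meas θm θM h
  set F : ℝ × ℝ → ℂ := fun x => (f x).1 + Complex.I * (f x).2 with hF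
  -- continuity of f on the closure
  have hfc : ContinuousOn f (closure S) := by
    intro y hy
    rw [ContinuousWithinAt, tendsto_iff_norm_sub_tendsto_zero]
    have hlim : Tendsto (fun x : ℝ × ℝ =>
        C * Real.sqrt ((x.1 - y.1) ^ 2 + (x.2 - y.2) ^ 2) ^ α) (nhdsWithin y (closure S))
        (nhds 0) := by
      have hcont : Continuous (fun x : ℝ × ℝ =>
        C * Real.sqrt ((x.1 - y.1) ^ 2 + (x.2 - y.2) ^ 2) ^ α) := by
        refine continuous_const.mul (Continuous.rpow_const (by fun_prop) (fun _ => Or.inr hα.le))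
      have := hcont.tendsto y
      simp [Real.zero_rpow hα.ne'] at this
      exact this.mono_left nhdsWithin_le_nhds
    refine squeeze_zero' (Eventually.of_forall fun _ => norm_nonneg _) ?_ hlim
    filter_upwards [self_mem_nhdsWithin] with x hx
    exact hf x hx y hy
  have hFc : ContinuousOn F (closure S) := by
    have a1 := continuous_fst.comp_continuousOn hfc
    have a2 := continuous_snd.comp_continuousOn hfc
    exact a1.add (continuousOn_const.mul a2)
  have hFm : Measurable (S.indicator F) := by
    classical
    rw [← Set.piecewise_eq_indicator]
    exact (hFc.mono subset_closure).measurable_piecewise continuousOn_const hSm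
  -- radial convergence to the origin
  have hpath : ∀ r θ : ℝ, 0 < r → θ ∈ Ioo θm θM →
      Tendsto (fun s : ℝ => ((s ^ 2)⁻¹ * r * Real.cos θ, (s ^ 2)⁻¹ * r * Real.sin θ)) atTop
        (nhdsWithin ((0 : ℝ), (0 : ℝ)) S) := by
    intro r θ hr hθ
    have t0 : Tendsto (fun s : ℝ => (s ^ 2)⁻¹) atTop (nhds 0) :=
      tendsto_inv_atTop_zero.comp (tendsto_pow_atTop two_ne_zero)
    have t1 : Tendsto (fun s : ℝ => (s ^ 2)⁻¹ * r) atTop (nhds 0) := by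
      simpa using t0.mul_const r
    rw [tendsto_nhdsWithin_iff]
    constructor
    · have t2 := t1.mul_const (Real.cos θ)
      have t3 := t1.mul_const (Real.sin θ)
      rw [zero_mul] at t2 t3
      exact t2.prodMk_nhds t3
    · filter_upwards [t1.eventually (gt_mem_nhds hh), eventually_gt_atTop 0] with s hs hs0
      rw [hS, aux_mem _ _ _ _ _ (by positivity) ⟨lt_trans h1 hθ.1, lt_trans hθ.2 h3⟩]
      exact ⟨hθ, hs⟩
  have h0 : ((0 : ℝ), (0 : ℝ)) ∈ closure S := by
    rw [mem_closure_iff_nhdsWithin_neBot]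
    have := hpath 1 ((θm + θM) / 2) one_pos ⟨by linarith, by linarith⟩
    exact this.neBot
  -- boundedness
  obtain ⟨M, hM0, hM⟩ : ∃ M : ℝ, 0 ≤ M ∧ ∀ x, ‖S.indicator F x‖ ≤ M := by
    set N := C * h ^ α + ‖f (0, 0)‖ with hN
    have hN0 : 0 ≤ N := by positivity
    refine ⟨N + N, by positivity, fun x => ?_⟩
    by_cases hx : x ∈ S
    · rw [indicator_of_mem hx]
      have hfx : ‖f x‖ ≤ N := by
        have e1 := hf x (subset_closure hx) _ h0
        have e2 : Real.sqrt ((x.1 - 0) ^ 2 + (x.2 - 0) ^ 2) ≤ h := by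
          have : ‖(x.1 + x.2 * Complex.I : ℂ)‖ < h := hx.2
          rw [Complex.norm_add_mul_I] at this
          simpa using this.le
        have e3 : Real.sqrt ((x.1 - 0) ^ 2 + (x.2 - 0) ^ 2) ^ α ≤ h ^ α :=
          Real.rpow_le_rpow (Real.sqrt_nonneg _) e2 hα.le
        have e4 := norm_le_norm_sub_add (f x) (f (0, 0))
        have e5 := mul_le_mul_of_nonneg_left e3 hC
        simp only at e1
        linarith
      have b1 := norm_fst_le (f x)
      have b2 := norm_snd_le (f x)
      calc ‖F x‖ ≤ ‖(f x).1‖ + ‖Complex.I * (f x).2‖ := norm_add_le _ _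
        _ ≤ N + N := by rw [norm_mul, Complex.norm_I, one_mul]; linarith
    · rw [indicator_of_notMem hx, norm_zero]; positivity
  have hmain : Tendsto (fun s : ℝ => ∫ p in Ioi (0 : ℝ) ×ˢ Ioo θm θM, p.1 •
      (Complex.exp (-((Real.sqrt p.1 : ℂ) * Complex.exp ((p.2 / 2 : ℝ) * Complex.I))) *
        S.indicator F
          ((s ^ 2)⁻¹ * p.1 * Real.cos p.2, (s ^ 2)⁻¹ * p.1 * Real.sin p.2))) atTop
      (nhds (∫ p in Ioi (0 : ℝ) ×ˢ Ioo θm θM, p.1 •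
      (Complex.exp (-((Real.sqrt p.1 : ℂ) * Complex.exp ((p.2 / 2 : ℝ) * Complex.I))) *
        F (0, 0)))) := by
    refine tendsto_integral_filter_of_dominated_convergence _ ?_ ?_
      (aux_bound_int θm θM c M hc) ?_
    · refine Eventually.of_forall fun s => Measurable.aestronglyMeasurable ?_
      have hp : Measurable (fun p : ℝ × ℝ =>
        ((s ^ 2)⁻¹ * p.1 * Real.cos p.2, (s ^ 2)⁻¹ * p.1 * Real.sin p.2)) := by fun_prop
      have := hFm.comp hp
      refine measurable_fst.smul (Measurable.mul (by fun_prop) this)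
    · refine Eventually.of_forall fun s => ?_
      filter_upwards [ae_restrict_mem (measurableSet_Ioi.prod measurableSet_Ioo)] with p hp
      have hp1 : 0 < p.1 := hp.1
      rw [norm_smul, norm_mul, aux_exp_norm, Real.norm_of_nonneg hp1.le, mul_assoc p.1 (Real.exp (-(c * Real.sqrt p.1)))]
      have := hcos p.2 hp.2
      refine mul_le_mul_of_nonneg_left ?_ hp1.le
      refine mul_le_mul (Real.exp_le_exp.2 (neg_le_neg ?_)) (hM _) (norm_nonneg _)
        (Real.exp_pos _).le
      rw [mul_comm c]
      gcongr
    · filter_upwards [ae_restrict_mem (measurableSet_Ioi.prod measurableSet_Ioo)] with p hp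
      refine Tendsto.const_smul (Tendsto.const_mul _ ?_) _
      have hp' := hpath p.1 p.2 hp.1 hp.2
      have hFt : Tendsto F (nhdsWithin (0, 0) S) (nhds (F (0, 0))) :=
        (hFc _ h0).mono_left (nhdsWithin_mono _ subset_closure)
      refine (hFt.comp hp').congr' ?_
      have := (tendsto_nhdsWithin_iff.1 hp').2
      filter_upwards [this] with s hs
      rw [indicator_of_mem hs]; rfl
  rw [aux_outer θm θM h1 h2 h3] at hmain
  refine hmain.congr' ?_
  filter_upwards [eventually_gt_atTop 0] with s hs
  rw [← aux_transform θm θM h h1 h3 F s hs]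
  congr 2
  ext x
  simp only [cdot, vfun, hF]
  ring
end
end

section
/- Let λ, μ ∈ ℝ with μ > 0 and 2λ + 2μ > 0, let ω > 0 and α ∈ (0,1). Let −π < θ_m < θ_M < π with θ_M ≠ θ_m + π, let K be the open planar sector with angles θ_m, θ_M, h > 0 and B = B(0,h). Let f : ℝ² → ℂ² be α-Hölder continuous on the closure of K ∩ B, and let u : ℝ² → ℂ² be twice continuously differentiable on an open neighbourhood of the closure of K ∩ B and satisfy λΔu + (λ+μ)∇(∇·u) + ω²u = f pointwise on K ∩ B. If u = 0 and T_ν u = 0 at every point of the two open radial boundary segments Σ (with ν the outward unit normal of K), then f(0) = 0. -/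
noncomputable section

open Complex MeasureTheory Real Set

/-- The planar Lamé operator 𝓛u = λΔu + (λ+μ)∇(∇·u). -/
def Lame (lam mu : ℝ) (u : ℝ × ℝ → ℂ × ℂ) (x : ℝ × ℝ) : ℂ × ℂ :=
  ((lam : ℂ) * (pd1 (pd1 fun y => (u y).1) x + pd2 (pd2 fun y => (u y).1) x)
      + ((lam : ℂ) + (mu : ℂ)) * (pd1 (pd1 fun y => (u y).1) x + pd1 (pd2 fun y => (u y).2) x),
   (lam : ℂ) * (pd1 (pd1 fun y => (u y).2) x + pd2 (pd2 fun y => (u y).2) x)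
      + ((lam : ℂ) + (mu : ℂ)) * (pd1 (pd2 fun y => (u y).1) x + pd2 (pd2 fun y => (u y).2) x))

theorem pd1_eq_fd {g : ℝ × ℝ → ℂ} {x : ℝ × ℝ} (hg : DifferentiableAt ℝ g x) :
    pd1 g x = fderiv ℝ g x (1, 0) := by
  have h1 : HasDerivAt (fun t : ℝ => ((t, x.2) : ℝ × ℝ)) (1, 0) x.1 :=
    (hasDerivAt_id x.1).prodMk (hasDerivAt_const x.1 x.2)
  have h2 : HasFDerivAt g (fderiv ℝ g x) ((fun t : ℝ => ((t, x.2) : ℝ × ℝ)) x.1) :=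
    hg.hasFDerivAt
  exact (h2.comp_hasDerivAt x.1 h1).deriv

theorem pd2_eq_fd {g : ℝ × ℝ → ℂ} {x : ℝ × ℝ} (hg : DifferentiableAt ℝ g x) :
    pd2 g x = fderiv ℝ g x (0, 1) := by
  have h1 : HasDerivAt (fun t : ℝ => ((x.1, t) : ℝ × ℝ)) (0, 1) x.2 :=
    (hasDerivAt_const x.2 x.1).prodMk (hasDerivAt_id x.2)
  have h2 : HasFDerivAt g (fderiv ℝ g x) ((fun t : ℝ => ((x.1, t) : ℝ × ℝ)) x.2) :=
    hg.hasFDerivAt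
  exact (h2.comp_hasDerivAt x.2 h1).deriv

theorem fd_split (L : ℝ × ℝ →L[ℝ] ℂ) (c s : ℝ) :
    L (c, s) = (c : ℂ) * L (1, 0) + (s : ℂ) * L (0, 1) := by
  have : ((c, s) : ℝ × ℝ) = c • ((1, 0) : ℝ × ℝ) + s • ((0, 1) : ℝ × ℝ) := by
    ext <;> simp
  rw [this, map_add, map_smul, map_smul]
  simp

/-- directional derivative vanishes along a ray on which `g` vanishes -/
theorem ray_deriv {g : ℝ × ℝ → ℂ} {c s δ r : ℝ} (hr : r < δ)
    (hg : DifferentiableAt ℝ g (r * c, r * s))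
    (hz : ∀ t, r < t → t < δ → g (t * c, t * s) = 0) :
    g (r * c, r * s) = 0 ∧
    (c : ℂ) * pd1 g (r * c, r * s) + (s : ℂ) * pd2 g (r * c, r * s) = 0 := by
  have h1 : HasDerivAt (fun t : ℝ => ((t * c, t * s) : ℝ × ℝ)) (c, s) r := by
    simpa using ((hasDerivAt_id r).mul_const c).prodMk ((hasDerivAt_id r).mul_const s)
  have h2 : HasFDerivAt g (fderiv ℝ g (r * c, r * s))
      ((fun t : ℝ => ((t * c, t * s) : ℝ × ℝ)) r) := hg.hasFDerivAt
  have h3 := h2.comp_hasDerivAt r h1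
  have hev : (g ∘ fun t : ℝ => ((t * c, t * s) : ℝ × ℝ)) =ᶠ[nhdsWithin r (Ioi r)]
      fun _ => (0 : ℂ) := by
    filter_upwards [Ioo_mem_nhdsGT hr] with t ht
    exact hz t ht.1 ht.2
  have h0 : g (r * c, r * s) = 0 := by
    have t1 : Filter.Tendsto (g ∘ fun t : ℝ => ((t * c, t * s) : ℝ × ℝ))
        (nhdsWithin r (Ioi r)) (nhds (g (r * c, r * s))) :=
      h3.continuousAt.tendsto.mono_left nhdsWithin_le_nhds
    exact tendsto_nhds_unique (t1.congr' hev) tendsto_const_nhds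
  refine ⟨h0, ?_⟩
  have h4 : HasDerivWithinAt (fun _ : ℝ => (0 : ℂ)) (fderiv ℝ g (r * c, r * s) (c, s))
      (Ioi r) r :=
    (h3.hasDerivWithinAt (s := Ioi r)).congr_of_eventuallyEq hev.symm h0.symm
  have h5 := (uniqueDiffWithinAt_Ioi r).eq_deriv _ h4 (hasDerivWithinAt_const r (Ioi r) (0 : ℂ))
  rw [pd1_eq_fd hg, pd2_eq_fd hg, ← fd_split, h5]

theorem two_dirs {c s c' s' : ℝ} (hdet : c * s' - s * c' ≠ 0) {a b : ℂ}
    (e1 : (c : ℂ) * a + (s : ℂ) * b = 0) (e2 : (c' : ℂ) * a + (s' : ℂ) * b = 0) :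
    a = 0 ∧ b = 0 := by
  have hd : (c : ℂ) * s' - s * c' ≠ 0 := by exact_mod_cast hdet
  constructor
  · apply (mul_eq_zero.1 (_ : ((c : ℂ) * s' - s * c') * a = 0)).resolve_left hd
    linear_combination (s' : ℂ) * e1 - (s : ℂ) * e2
  · apply (mul_eq_zero.1 (_ : ((c : ℂ) * s' - s * c') * b = 0)).resolve_left hd
    linear_combination (c : ℂ) * e2 - (c' : ℂ) * e1

theorem traction_alg {lam mu c s : ℝ} (hmu : mu ≠ 0) (hl : lam + 2 * mu ≠ 0)
    (hcs : s ^ 2 + c ^ 2 = 1) {a1 b1 a2 b2 : ℂ}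
    (e1 : (c : ℂ) * a1 + (s : ℂ) * b1 = 0) (e2 : (c : ℂ) * a2 + (s : ℂ) * b2 = 0)
    (t1 : 2 * (mu : ℂ) * ((s : ℂ) * a1 - (c : ℂ) * b1) + (lam : ℂ) * (s : ℂ) * (a1 + b2)
      + (mu : ℂ) * (c : ℂ) * (b1 - a2) = 0)
    (t2 : 2 * (mu : ℂ) * ((s : ℂ) * a2 - (c : ℂ) * b2) - (lam : ℂ) * (c : ℂ) * (a1 + b2)
      + (mu : ℂ) * (s : ℂ) * (b1 - a2) = 0) :
    a1 = 0 ∧ b1 = 0 ∧ a2 = 0 ∧ b2 = 0 := by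
  have hm : (mu : ℂ) ≠ 0 := by exact_mod_cast hmu
  have hl' : (lam : ℂ) + 2 * mu ≠ 0 := by exact_mod_cast hl
  have h : (s : ℂ) ^ 2 + (c : ℂ) ^ 2 = 1 := by exact_mod_cast hcs
  obtain ⟨n1, hn1⟩ : ∃ n1, n1 = (s : ℂ) * a1 - (c : ℂ) * b1 := ⟨_, rfl⟩
  obtain ⟨n2, hn2⟩ : ∃ n2, n2 = (s : ℂ) * a2 - (c : ℂ) * b2 := ⟨_, rfl⟩
  have ha1 : a1 = s * n1 := by rw [hn1]; linear_combination (c : ℂ) * e1 - a1 * h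
  have hb1 : b1 = -c * n1 := by rw [hn1]; linear_combination (s : ℂ) * e1 - b1 * h
  have ha2 : a2 = s * n2 := by rw [hn2]; linear_combination (c : ℂ) * e2 - a2 * h
  have hb2 : b2 = -c * n2 := by rw [hn2]; linear_combination (s : ℂ) * e2 - b2 * h
  rw [← hn1, ha1, hb1, ha2, hb2] at t1
  rw [← hn2, ha1, hb1, ha2, hb2] at t2
  have hN : (s : ℂ) * n1 - c * n2 = 0 := by
    apply (mul_eq_zero.1 (_ : ((lam : ℂ) + 2 * mu) * (s * n1 - c * n2) = 0)).resolve_left hl'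
    linear_combination (s : ℂ) * t1 - (c : ℂ) * t2 - (lam : ℂ) * (s * n1 - c * n2) * h
  have hT : (c : ℂ) * n1 + s * n2 = 0 := by
    apply (mul_eq_zero.1 (_ : (mu : ℂ) * (c * n1 + s * n2) = 0)).resolve_left hm
    linear_combination (c : ℂ) * t1 + (s : ℂ) * t2 + (mu : ℂ) * (c * n1 + s * n2) * h
  have z1 : n1 = 0 := by linear_combination (s : ℂ) * hN + (c : ℂ) * hT - n1 * h
  have z2 : n2 = 0 := by linear_combination (s : ℂ) * hT - (c : ℂ) * hN - n2 * h
  simp [ha1, hb1, ha2, hb2, z1, z2]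

theorem pd1_contDiffOn {g : ℝ × ℝ → ℂ} {O : Set (ℝ × ℝ)} (hO : IsOpen O) {m n : WithTop ℕ∞}
    (hmn : m + 1 ≤ n) (hg : ContDiffOn ℝ n g O) : ContDiffOn ℝ m (pd1 g) O := by
  have h1 : ContDiffOn ℝ m (fun x => fderiv ℝ g x (1, 0)) O :=
    (hg.fderiv_of_isOpen hO hmn).clm_apply contDiffOn_const
  refine h1.congr fun x hx => pd1_eq_fd ?_
  refine ((hg x hx).contDiffAt (hO.mem_nhds hx)).differentiableAt ?_
  rintro rfl
  simp at hmn

theorem pd2_contDiffOn {g : ℝ × ℝ → ℂ} {O : Set (ℝ × ℝ)} (hO : IsOpen O) {m n : WithTop ℕ∞}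
    (hmn : m + 1 ≤ n) (hg : ContDiffOn ℝ n g O) : ContDiffOn ℝ m (pd2 g) O := by
  have h1 : ContDiffOn ℝ m (fun x => fderiv ℝ g x (0, 1)) O :=
    (hg.fderiv_of_isOpen hO hmn).clm_apply contDiffOn_const
  refine h1.congr fun x hx => pd2_eq_fd ?_
  refine ((hg x hx).contDiffAt (hO.mem_nhds hx)).differentiableAt ?_
  rintro rfl
  simp at hmn

/-- A function differentiable at the origin which vanishes on two independent rays has vanishing
value and first partials at the origin. -/
theorem corner_zero {g : ℝ × ℝ → ℂ} {c s c' s' δ : ℝ} (hδ : 0 < δ)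
    (hdet : c * s' - s * c' ≠ 0) (hg : DifferentiableAt ℝ g (0, 0))
    (hz : ∀ t, 0 < t → t < δ → g (t * c, t * s) = 0)
    (hz' : ∀ t, 0 < t → t < δ → g (t * c', t * s') = 0) :
    g (0, 0) = 0 ∧ pd1 g (0, 0) = 0 ∧ pd2 g (0, 0) = 0 := by
  have A := ray_deriv (g := g) (c := c) (s := s) hδ (by simpa using hg) hz
  have B := ray_deriv (g := g) (c := c') (s := s') hδ (by simpa using hg) hz'
  simp only [zero_mul] at A B
  exact ⟨A.1, two_dirs hdet A.2 B.2⟩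

theorem zero_mem_closure_sector {θm θM h : ℝ} (h1 : -π < θm) (h2 : θm < θM) (h3 : θM < π)
    (hh : 0 < h) : ((0, 0) : ℝ × ℝ) ∈ closure (sector θm θM ∩ disc h) := by
  set θ := (θm + θM) / 2 with hθ
  have t : Filter.Tendsto (fun r : ℝ => ((r * Real.cos θ, r * Real.sin θ) : ℝ × ℝ))
      (nhdsWithin 0 (Ioi 0)) (nhds (0, 0)) := by
    have : Continuous (fun r : ℝ => ((r * Real.cos θ, r * Real.sin θ) : ℝ × ℝ)) := by fun_prop
    have := this.tendsto 0
    simp only [zero_mul] at this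
    exact this.mono_left nhdsWithin_le_nhds
  refine mem_closure_of_tendsto t ?_
  filter_upwards [Ioo_mem_nhdsGT hh] with r hr
  have e : (((r * Real.cos θ : ℝ) : ℂ) + ((r * Real.sin θ : ℝ) : ℂ) * Complex.I)
      = (r : ℂ) * (Complex.cos θ + Complex.sin θ * Complex.I) := by
    push_cast; ring
  have ha : ((r : ℂ) * (Complex.cos θ + Complex.sin θ * Complex.I)).arg = θ :=
    Complex.arg_mul_cos_add_sin_mul_I hr.1 ⟨by linarith, by linarith⟩
  have hn : ‖(r : ℂ) * (Complex.cos θ + Complex.sin θ * Complex.I)‖ = r := by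
    rw [norm_mul, Complex.norm_cos_add_sin_mul_I, mul_one, Complex.norm_real,
      Real.norm_of_nonneg hr.1.le]
  refine ⟨⟨?_, ?_, ?_⟩, ?_⟩
  · show (((r * Real.cos θ : ℝ) : ℂ) + ((r * Real.sin θ : ℝ) : ℂ) * Complex.I) ≠ 0
    rw [e]
    intro h0
    rw [h0, norm_zero] at hn
    exact hr.1.ne hn
  · show _ < (((r * Real.cos θ : ℝ) : ℂ) + ((r * Real.sin θ : ℝ) : ℂ) * Complex.I).arg
    rw [e, ha]; linarith
  · show (((r * Real.cos θ : ℝ) : ℂ) + ((r * Real.sin θ : ℝ) : ℂ) * Complex.I).arg < _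
    rw [e, ha]; linarith
  · show ‖(((r * Real.cos θ : ℝ) : ℂ) + ((r * Real.sin θ : ℝ) : ℂ) * Complex.I)‖ < h
    rw [e, hn]; exact hr.2

theorem ray_in_open {O : Set (ℝ × ℝ)} (hO : IsOpen O) (h0 : ((0, 0) : ℝ × ℝ) ∈ O) {h : ℝ}
    (hh : 0 < h) : ∃ δ, 0 < δ ∧ δ ≤ h ∧ ∀ r, 0 < r → r < δ → ∀ θ : ℝ,
      ((r * Real.cos θ, r * Real.sin θ) : ℝ × ℝ) ∈ O := by
  obtain ⟨ε, hε, hb⟩ := Metric.isOpen_iff.1 hO _ h0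
  refine ⟨min ε h, lt_min hε hh, min_le_right _ _, fun r hr hr' θ => hb ?_⟩
  have hr2 : r < ε := lt_of_lt_of_le hr' (min_le_left _ _)
  rw [Metric.mem_ball, Prod.dist_eq, max_lt_iff]
  simp only [Real.dist_eq, sub_zero, abs_mul, abs_of_pos hr]
  constructor
  · nlinarith [Real.abs_cos_le_one θ]
  · nlinarith [Real.abs_sin_le_one θ]

theorem ray_grad_zero {lam mu c s δ : ℝ} (hmu : mu ≠ 0) (hl : lam + 2 * mu ≠ 0)
    (hcs : s ^ 2 + c ^ 2 = 1) {u : ℝ × ℝ → ℂ × ℂ}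
    (hd1 : ∀ r, 0 < r → r < δ → DifferentiableAt ℝ (fun y => (u y).1) (r * c, r * s))
    (hd2 : ∀ r, 0 < r → r < δ → DifferentiableAt ℝ (fun y => (u y).2) (r * c, r * s))
    (hu : ∀ r, 0 < r → r < δ → u (r * c, r * s) = 0)
    (ht : ∀ r, 0 < r → r < δ → traction lam mu (s, -c) u (r * c, r * s) = 0) :
    ∀ r, 0 < r → r < δ → pd1 (fun y => (u y).1) (r * c, r * s) = 0 ∧
      pd2 (fun y => (u y).1) (r * c, r * s) = 0 ∧ pd1 (fun y => (u y).2) (r * c, r * s) = 0 ∧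
      pd2 (fun y => (u y).2) (r * c, r * s) = 0 := by
  intro r hr hr'
  have A := (ray_deriv hr' (hd1 r hr hr') fun t h1 h2 => by rw [hu t (hr.trans h1) h2]; rfl).2
  have B := (ray_deriv hr' (hd2 r hr hr') fun t h1 h2 => by rw [hu t (hr.trans h1) h2]; rfl).2
  have T := ht r hr hr'
  have T1 := congrArg Prod.fst T
  have T2 := congrArg Prod.snd T
  simp only [traction, Prod.fst_zero, Prod.snd_zero, Complex.ofReal_neg] at T1 T2
  refine traction_alg hmu hl hcs A B ?_ ?_
  · linear_combination T1
  · linear_combination T2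

theorem stmt_10 (lam mu ω α θm θM h : ℝ)
    (hmu : 0 < mu) (hlam : 0 < 2 * lam + 2 * mu) (hω : 0 < ω) (hα : 0 < α) (hα' : α < 1)
    (h1 : -π < θm) (h2 : θm < θM) (h3 : θM < π) (hangle : θM ≠ θm + π) (hh : 0 < h)
    (f : ℝ × ℝ → ℂ × ℂ)
    (hf : ∃ C : ℝ, 0 ≤ C ∧ ∀ x ∈ closure (sector θm θM ∩ disc h),
      ∀ y ∈ closure (sector θm θM ∩ disc h),
        ‖f x - f y‖ ≤ C * Real.sqrt ((x.1 - y.1) ^ 2 + (x.2 - y.2) ^ 2) ^ α)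
    (u : ℝ × ℝ → ℂ × ℂ) (O : Set (ℝ × ℝ)) (hO : IsOpen O)
    (hsub : closure (sector θm θM ∩ disc h) ⊆ O) (hu : ContDiffOn ℝ 2 u O)
    (heq : ∀ x ∈ sector θm θM ∩ disc h,
      Lame lam mu u x + ((ω ^ 2 : ℝ) : ℂ) • u x = f x)
    (hbd : ∀ r : ℝ, 0 < r → r < h →
      u (r * Real.cos θm, r * Real.sin θm) = 0 ∧
      traction lam mu (Real.sin θm, -Real.cos θm) u (r * Real.cos θm, r * Real.sin θm) = 0 ∧
      u (r * Real.cos θM, r * Real.sin θM) = 0 ∧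
      traction lam mu (-Real.sin θM, Real.cos θM) u (r * Real.cos θM, r * Real.sin θM) = 0) :
    f (0, 0) = 0 := by
  have hcl := zero_mem_closure_sector h1 h2 h3 hh
  have h0O := hsub hcl
  obtain ⟨δ, hδ, hδh, hray⟩ := ray_in_open hO h0O hh
  have hg1 : ContDiffOn ℝ 2 (fun y => (u y).1) O := contDiff_fst.comp_contDiffOn hu
  have hg2 : ContDiffOn ℝ 2 (fun y => (u y).2) O := contDiff_snd.comp_contDiffOn hu
  have dif : ∀ {g : ℝ × ℝ → ℂ} {n : WithTop ℕ∞}, n ≠ 0 → ContDiffOn ℝ n g O →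
      ∀ x ∈ O, DifferentiableAt ℝ g x := fun hn hg x hx =>
    ((hg x hx).contDiffAt (hO.mem_nhds hx)).differentiableAt hn
  have hl : lam + 2 * mu ≠ 0 := by linarith
  have hdet : Real.cos θm * Real.sin θM - Real.sin θm * Real.cos θM ≠ 0 := by
    have e : Real.cos θm * Real.sin θM - Real.sin θm * Real.cos θM = Real.sin (θM - θm) := by
      rw [Real.sin_sub]; ring
    rw [e]
    rcases lt_or_gt_of_ne hangle with hlt | hgt
    · exact (Real.sin_pos_of_pos_of_lt_pi (by linarith) (by linarith)).ne'
    · have : 0 < Real.sin (θM - θm - π) :=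
        Real.sin_pos_of_pos_of_lt_pi (by linarith) (by linarith)
      rw [Real.sin_sub_pi] at this
      linarith
  have Gm := ray_grad_zero (lam := lam) (u := u) (δ := δ) hmu.ne' hl (Real.sin_sq_add_cos_sq θm)
    (fun r hr hr' => dif two_ne_zero hg1 _ (hray r hr hr' θm))
    (fun r hr hr' => dif two_ne_zero hg2 _ (hray r hr hr' θm))
    (fun r hr hr' => (hbd r hr (hr'.trans_le hδh)).1)
    (fun r hr hr' => (hbd r hr (hr'.trans_le hδh)).2.1)
  have GM := ray_grad_zero (lam := lam) (u := u) (δ := δ) hmu.ne' hl (Real.sin_sq_add_cos_sq θM)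
    (fun r hr hr' => dif two_ne_zero hg1 _ (hray r hr hr' θM))
    (fun r hr hr' => dif two_ne_zero hg2 _ (hray r hr hr' θM))
    (fun r hr hr' => (hbd r hr (hr'.trans_le hδh)).2.2.1)
    (fun r hr hr' => by
      have T := (hbd r hr (hr'.trans_le hδh)).2.2.2
      have T1 := congrArg Prod.fst T
      have T2 := congrArg Prod.snd T
      simp only [traction, Prod.fst_zero, Prod.snd_zero, Complex.ofReal_neg] at T1 T2
      ext1
      · simp only [traction, Prod.fst_zero, Complex.ofReal_neg]
        linear_combination -T1
      · simp only [traction, Prod.snd_zero, Complex.ofReal_neg]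
        linear_combination -T2)
  have h12 : (1 : WithTop ℕ∞) + 1 ≤ 2 := by norm_num
  have h01 : (0 : WithTop ℕ∞) + 1 ≤ 1 := by norm_num
  have p11 := pd1_contDiffOn hO h12 hg1
  have p21 := pd2_contDiffOn hO h12 hg1
  have p12 := pd1_contDiffOn hO h12 hg2
  have p22 := pd2_contDiffOn hO h12 hg2
  have z11 := corner_zero hδ hdet (dif one_ne_zero p11 _ h0O)
    (fun r a b => (Gm r a b).1) (fun r a b => (GM r a b).1)
  have z21 := corner_zero hδ hdet (dif one_ne_zero p21 _ h0O)
    (fun r a b => (Gm r a b).2.1) (fun r a b => (GM r a b).2.1)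
  have z12 := corner_zero hδ hdet (dif one_ne_zero p12 _ h0O)
    (fun r a b => (Gm r a b).2.2.1) (fun r a b => (GM r a b).2.2.1)
  have z22 := corner_zero hδ hdet (dif one_ne_zero p22 _ h0O)
    (fun r a b => (Gm r a b).2.2.2) (fun r a b => (GM r a b).2.2.2)
  have y1 := corner_zero hδ hdet (dif two_ne_zero hg1 _ h0O)
    (fun r a b => by rw [(hbd r a (b.trans_le hδh)).1]; rfl)
    (fun r a b => by rw [(hbd r a (b.trans_le hδh)).2.2.1]; rfl)
  have y2 := corner_zero hδ hdet (dif two_ne_zero hg2 _ h0O)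
    (fun r a b => by rw [(hbd r a (b.trans_le hδh)).1]; rfl)
    (fun r a b => by rw [(hbd r a (b.trans_le hδh)).2.2.1]; rfl)
  have hu0 : u (0, 0) = 0 := Prod.ext y1.1 y2.1
  have hL0 : Lame lam mu u (0, 0) = 0 := by
    simp only [Lame, z11, z21, z12, z22]
    simp
  have cO : ∀ {g : ℝ × ℝ → ℂ}, ContDiffOn ℝ 0 g O → ContinuousAt g (0, 0) := fun hg =>
    hg.continuousOn.continuousAt (hO.mem_nhds h0O)
  have c1 := cO (pd1_contDiffOn hO h01 p11)
  have c2 := cO (pd2_contDiffOn hO h01 p21)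
  have c3 := cO (pd1_contDiffOn hO h01 p22)
  have c4 := cO (pd1_contDiffOn hO h01 p12)
  have c5 := cO (pd2_contDiffOn hO h01 p22)
  have c6 := cO (pd1_contDiffOn hO h01 p21)
  have cu : ContinuousAt u (0, 0) := hu.continuousOn.continuousAt (hO.mem_nhds h0O)
  have cL : ContinuousAt (Lame lam mu u) (0, 0) := by
    unfold Lame
    exact ((continuousAt_const.mul (c1.add c2)).add (continuousAt_const.mul (c1.add c3))).prodMk
      ((continuousAt_const.mul (c4.add c5)).add (continuousAt_const.mul (c6.add c5)))
  have cF : ContinuousAt (fun x => Lame lam mu u x + ((ω ^ 2 : ℝ) : ℂ) • u x) (0, 0) :=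
    cL.add (cu.const_smul ((ω ^ 2 : ℝ) : ℂ))
  have tF : Filter.Tendsto f (nhdsWithin (0, 0) (sector θm θM ∩ disc h)) (nhds 0) := by
    have := cF.tendsto.mono_left (nhdsWithin_le_nhds (s := sector θm θM ∩ disc h))
    rw [hL0, hu0, smul_zero, add_zero] at this
    refine this.congr' ?_
    filter_upwards [self_mem_nhdsWithin] with x hx using heq x hx
  have tf : Filter.Tendsto f (nhdsWithin (0, 0) (sector θm θM ∩ disc h)) (nhds (f (0, 0))) := by
    obtain ⟨C, hC, hH⟩ := hf
    rw [tendsto_iff_norm_sub_tendsto_zero]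
    have hb : Filter.Tendsto (fun x : ℝ × ℝ =>
        C * Real.sqrt ((x.1 - 0) ^ 2 + (x.2 - 0) ^ 2) ^ α)
        (nhdsWithin (0, 0) (sector θm θM ∩ disc h)) (nhds 0) := by
      have hc : Continuous (fun x : ℝ × ℝ =>
          C * Real.sqrt ((x.1 - 0) ^ 2 + (x.2 - 0) ^ 2) ^ α) :=
        continuous_const.mul ((by fun_prop : Continuous (fun x : ℝ × ℝ =>
          Real.sqrt ((x.1 - 0) ^ 2 + (x.2 - 0) ^ 2))).rpow_const fun _ => Or.inr hα.le)
      have := hc.tendsto (0, 0)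
      simp only [sub_self, ne_eq, OfNat.ofNat_ne_zero, not_false_eq_true, zero_pow, add_zero,
        Real.sqrt_zero, Real.zero_rpow hα.ne', mul_zero] at this
      exact this.mono_left nhdsWithin_le_nhds
    refine squeeze_zero' (Filter.Eventually.of_forall fun _ => norm_nonneg _) ?_ hb
    filter_upwards [self_mem_nhdsWithin] with x hx
    exact hH x (subset_closure hx) (0, 0) hcl
  haveI : (nhdsWithin ((0, 0) : ℝ × ℝ) (sector θm θM ∩ disc h)).NeBot :=
    mem_closure_iff_nhdsWithin_neBot.1 hcl
  exact tendsto_nhds_unique tf tF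
end
end

section
/- Let λ, μ ∈ ℝ with μ > 0 and 3λ + 2μ > 0, and let α ∈ (0,1). Let −π < θ_m < θ_M < π with θ_M ≠ θ_m + π, let K ⊂ ℝ² be the open planar sector with angles θ_m, θ_M, let h > 0, B = B(0,h) ⊂ ℝ², L > 0, and set Q = (K ∩ B) × (−L, L) ⊂ ℝ³. Let f : ℝ³ → ℂ³ be α-Hölder continuous on the closure of Q, and let u : ℝ³ → ℂ³ be twice continuously differentiable on an open neighbourhood of the closure of Q and satisfy 𝓛u = f pointwise on Q. If u = 0 and T_ν u = 0 at every point of the two faces Σ × (−L, L), where Σ denotes the two open radial boundary segments of K in B and ν = (n, 0) with n the outward unit normal of K, then f(0,0,0) = 0. -/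
noncomputable section

open Complex MeasureTheory Real Set

/-- Partial derivatives of `f : ℝ³ → ℂ` with `ℝ³ = (ℝ × ℝ) × ℝ`, `x = (x', x₃)`. -/
def qd1 (f : (ℝ × ℝ) × ℝ → ℂ) (x : (ℝ × ℝ) × ℝ) : ℂ :=
  deriv (fun t => f ((t, x.1.2), x.2)) x.1.1

def qd2 (f : (ℝ × ℝ) × ℝ → ℂ) (x : (ℝ × ℝ) × ℝ) : ℂ :=
  deriv (fun t => f ((x.1.1, t), x.2)) x.1.2

def qd3 (f : (ℝ × ℝ) × ℝ → ℂ) (x : (ℝ × ℝ) × ℝ) : ℂ :=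
  deriv (fun t => f (x.1, t)) x.2

/-- The divergence `∇·u` of `u : ℝ³ → ℂ³`. -/
def div3 (u : (ℝ × ℝ) × ℝ → ℂ × ℂ × ℂ) (x : (ℝ × ℝ) × ℝ) : ℂ :=
  qd1 (fun y => (u y).1) x + qd2 (fun y => (u y).2.1) x + qd3 (fun y => (u y).2.2) x

/-- The 3D Lamé operator `𝓛u = λΔu + (λ+μ)∇(∇·u)`. -/
def Lame3 (lam mu : ℝ) (u : (ℝ × ℝ) × ℝ → ℂ × ℂ × ℂ) (x : (ℝ × ℝ) × ℝ) : ℂ × ℂ × ℂ :=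
  ((lam : ℂ) * (qd1 (qd1 fun y => (u y).1) x + qd2 (qd2 fun y => (u y).1) x
        + qd3 (qd3 fun y => (u y).1) x) + ((lam : ℂ) + (mu : ℂ)) * qd1 (div3 u) x,
   (lam : ℂ) * (qd1 (qd1 fun y => (u y).2.1) x + qd2 (qd2 fun y => (u y).2.1) x
        + qd3 (qd3 fun y => (u y).2.1) x) + ((lam : ℂ) + (mu : ℂ)) * qd2 (div3 u) x,
   (lam : ℂ) * (qd1 (qd1 fun y => (u y).2.2) x + qd2 (qd2 fun y => (u y).2.2) x
        + qd3 (qd3 fun y => (u y).2.2) x) + ((lam : ℂ) + (mu : ℂ)) * qd3 (div3 u) x)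

/-- The 3D boundary traction operator `T_ν u = 2μ(∂u/∂ν) + λν(∇·u) + μν×(∇×u)`. -/
def traction3 (lam mu : ℝ) (ν : (ℝ × ℝ) × ℝ) (u : (ℝ × ℝ) × ℝ → ℂ × ℂ × ℂ)
    (x : (ℝ × ℝ) × ℝ) : ℂ × ℂ × ℂ :=
  let d1 : ℂ × ℂ × ℂ :=
    (qd1 (fun y => (u y).1) x, qd1 (fun y => (u y).2.1) x, qd1 (fun y => (u y).2.2) x)
  let d2 : ℂ × ℂ × ℂ :=
    (qd2 (fun y => (u y).1) x, qd2 (fun y => (u y).2.1) x, qd2 (fun y => (u y).2.2) x)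
  let d3 : ℂ × ℂ × ℂ :=
    (qd3 (fun y => (u y).1) x, qd3 (fun y => (u y).2.1) x, qd3 (fun y => (u y).2.2) x)
  let divu : ℂ := d1.1 + d2.2.1 + d3.2.2
  let c : ℂ × ℂ × ℂ := (d2.2.2 - d3.2.1, d3.1 - d1.2.2, d1.2.1 - d2.1)
  let n1 : ℂ := (ν.1.1 : ℂ)
  let n2 : ℂ := (ν.1.2 : ℂ)
  let n3 : ℂ := (ν.2 : ℂ)
  (2 * (mu : ℂ) * (n1 * d1.1 + n2 * d2.1 + n3 * d3.1) + (lam : ℂ) * n1 * divu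
      + (mu : ℂ) * (n2 * c.2.2 - n3 * c.2.1),
   2 * (mu : ℂ) * (n1 * d1.2.1 + n2 * d2.2.1 + n3 * d3.2.1) + (lam : ℂ) * n2 * divu
      + (mu : ℂ) * (n3 * c.1 - n1 * c.2.2),
   2 * (mu : ℂ) * (n1 * d1.2.2 + n2 * d2.2.2 + n3 * d3.2.2) + (lam : ℂ) * n3 * divu
      + (mu : ℂ) * (n1 * c.2.1 - n2 * c.1))

open Filter Topology

abbrev E3 := (ℝ × ℝ) × ℝ
abbrev e1 : E3 := ((1, 0), 0)
abbrev e2 : E3 := ((0, 1), 0)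
abbrev e3 : E3 := ((0, 0), 1)

lemma qd1_eq {g : E3 → ℂ} {x : E3} (hg : DifferentiableAt ℝ g x) :
    qd1 g x = fderiv ℝ g x e1 := by
  have hc : HasDerivAt (fun t : ℝ => (((t, x.1.2), x.2) : E3)) e1 x.1.1 :=
    ((hasDerivAt_id _).prodMk (hasDerivAt_const _ _)).prodMk (hasDerivAt_const _ _)
  exact (HasFDerivAt.comp_hasDerivAt (x := x.1.1) (f := fun t : ℝ => (((t, x.1.2), x.2) : E3))
    hg.hasFDerivAt hc).deriv

lemma qd2_eq {g : E3 → ℂ} {x : E3} (hg : DifferentiableAt ℝ g x) :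
    qd2 g x = fderiv ℝ g x e2 := by
  have hc : HasDerivAt (fun t : ℝ => (((x.1.1, t), x.2) : E3)) e2 x.1.2 :=
    ((hasDerivAt_const _ _).prodMk (hasDerivAt_id _)).prodMk (hasDerivAt_const _ _)
  exact (HasFDerivAt.comp_hasDerivAt (x := x.1.2) (f := fun t : ℝ => (((x.1.1, t), x.2) : E3))
    hg.hasFDerivAt hc).deriv

lemma qd3_eq {g : E3 → ℂ} {x : E3} (hg : DifferentiableAt ℝ g x) :
    qd3 g x = fderiv ℝ g x e3 := by
  have hc : HasDerivAt (fun t : ℝ => ((x.1, t) : E3)) e3 x.2 :=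
    (hasDerivAt_const _ _).prodMk (hasDerivAt_id _)
  exact (HasFDerivAt.comp_hasDerivAt (x := x.2) (f := fun t : ℝ => ((x.1, t) : E3))
    hg.hasFDerivAt hc).deriv

section scal
variable {g : E3 → ℂ} {O : Set E3}

lemma diffAt_of (hO : IsOpen O) (hg : ContDiffOn ℝ 2 g O) {x : E3} (hx : x ∈ O) :
    DifferentiableAt ℝ g x :=
  (hg.contDiffAt (hO.mem_nhds hx)).differentiableAt (by norm_num)

lemma cd_fderiv (hO : IsOpen O) (hg : ContDiffOn ℝ 2 g O) :
    ContDiffOn ℝ 1 (fderiv ℝ g) O := hg.fderiv_of_isOpen hO (by norm_num)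

lemma dir_hasFDeriv (hO : IsOpen O) (hg : ContDiffOn ℝ 2 g O) {x : E3} (hx : x ∈ O) (v : E3) :
    HasFDerivAt (fun y => fderiv ℝ g y v) ((fderiv ℝ (fderiv ℝ g) x).flip v) x := by
  have h := (((cd_fderiv hO hg).contDiffAt (hO.mem_nhds hx)).differentiableAt
    (by norm_num)).hasFDerivAt
  have := h.clm_apply (hasFDerivAt_const v x)
  simpa using this

/-- `q` acts as the directional derivative in direction `v` on C² functions. -/
lemma qd_hasFDeriv (hO : IsOpen O) (hg : ContDiffOn ℝ 2 g O) {q : (E3 → ℂ) → E3 → ℂ} {v : E3}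
    (hq : ∀ x, DifferentiableAt ℝ g x → q g x = fderiv ℝ g x v) {x : E3} (hx : x ∈ O) :
    HasFDerivAt (q g) ((fderiv ℝ (fderiv ℝ g) x).flip v) x := by
  refine (dir_hasFDeriv hO hg hx v).congr_of_eventuallyEq ?_
  filter_upwards [hO.mem_nhds hx] with y hy
  exact hq y (diffAt_of hO hg hy)

lemma D2_tendsto (hO : IsOpen O) (hg : ContDiffOn ℝ 2 g O) (h0 : (0 : E3) ∈ O)
    (hz : fderiv ℝ (fderiv ℝ g) 0 = 0) (v w : E3) :
    Tendsto (fun x => fderiv ℝ (fderiv ℝ g) x v w) (𝓝 0) (𝓝 0) := by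
  have h : ContDiffOn ℝ 0 (fderiv ℝ (fderiv ℝ g)) O :=
    (cd_fderiv hO hg).fderiv_of_isOpen hO (by norm_num)
  have hc := h.continuousOn.continuousAt (hO.mem_nhds h0)
  have : ContinuousAt (fun x => fderiv ℝ (fderiv ℝ g) x v w) 0 :=
    (hc.clm_apply continuousAt_const).clm_apply continuousAt_const
  simpa [ContinuousAt, hz] using this

end scal

/-- vanishing along a ray forces the derivative to vanish in that direction -/
lemma deriv_ray_zero {G : Type*} [NormedAddCommGroup G] [NormedSpace ℝ G] {D : E3 → G} {p v : E3}
    (hD : DifferentiableAt ℝ D p)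
    (h : ∀ᶠ s in 𝓝[>] (0 : ℝ), D (p + s • v) = 0) : D p = 0 ∧ fderiv ℝ D p v = 0 := by
  have hp : Tendsto (fun s : ℝ => p + s • v) (𝓝 0) (𝓝 p) := by
    have : Continuous (fun s : ℝ => p + s • v) := by fun_prop
    simpa using this.tendsto 0
  have h0 : D p = 0 := by
    have t1 : Tendsto (fun s : ℝ => D (p + s • v)) (𝓝[>] 0) (𝓝 (D p)) :=
      (hD.continuousAt.tendsto.comp hp).mono_left nhdsWithin_le_nhds
    have t2 : Tendsto (fun s : ℝ => D (p + s • v)) (𝓝[>] 0) (𝓝 0) :=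
      tendsto_const_nhds.congr' (by filter_upwards [h] with s hs using hs.symm)
    exact tendsto_nhds_unique t1 t2
  refine ⟨h0, ?_⟩
  have hl : HasDerivAt (fun s : ℝ => p + s • v) v 0 := by
    simpa using ((hasDerivAt_id (0 : ℝ)).smul_const v).const_add p
  have hD' : HasFDerivAt D (fderiv ℝ D p) (p + (0 : ℝ) • v) := by
    simpa using hD.hasFDerivAt
  have hc : HasDerivWithinAt (fun s : ℝ => D (p + s • v)) (fderiv ℝ D p v) (Ioi 0) 0 :=
    (HasFDerivAt.comp_hasDerivAt (x := (0 : ℝ)) (f := fun s : ℝ => p + s • v)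
      hD' hl).hasDerivWithinAt
  have hz : HasDerivWithinAt (fun s : ℝ => D (p + s • v)) 0 (Ioi 0) 0 :=
    (hasDerivWithinAt_const (0 : ℝ) (Ioi 0) (0 : G)).congr_of_eventuallyEq h (by simp [h0])
  exact (uniqueDiffWithinAt_Ioi (0 : ℝ)).eq_deriv _ hc hz

lemma trac_alg (lam mu : ℝ) (hmu : 0 < mu) (hlam : 0 < 3 * lam + 2 * mu) (n1 n2 : ℝ)
    (hn : n1 ^ 2 + n2 ^ 2 = 1) (u : E3 → ℂ × ℂ × ℂ) (x : E3)
    (a1 : (n2 : ℂ) * qd1 (fun y => (u y).1) x = n1 * qd2 (fun y => (u y).1) x)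
    (a2 : (n2 : ℂ) * qd1 (fun y => (u y).2.1) x = n1 * qd2 (fun y => (u y).2.1) x)
    (a3 : (n2 : ℂ) * qd1 (fun y => (u y).2.2) x = n1 * qd2 (fun y => (u y).2.2) x)
    (b1 : qd3 (fun y => (u y).1) x = 0)
    (b2 : qd3 (fun y => (u y).2.1) x = 0)
    (b3 : qd3 (fun y => (u y).2.2) x = 0)
    (ht : traction3 lam mu ((n1, n2), 0) u x = 0) :
    (qd1 (fun y => (u y).1) x = 0 ∧ qd2 (fun y => (u y).1) x = 0) ∧
    (qd1 (fun y => (u y).2.1) x = 0 ∧ qd2 (fun y => (u y).2.1) x = 0) ∧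
    (qd1 (fun y => (u y).2.2) x = 0 ∧ qd2 (fun y => (u y).2.2) x = 0) := by
  simp only [traction3, b1, b2, b3, Prod.mk_eq_zero] at ht
  generalize qd1 (fun y => (u y).1) x = p1 at *
  generalize qd1 (fun y => (u y).2.1) x = p2 at *
  generalize qd1 (fun y => (u y).2.2) x = p3 at *
  generalize qd2 (fun y => (u y).1) x = q1 at *
  generalize qd2 (fun y => (u y).2.1) x = q2 at *
  generalize qd2 (fun y => (u y).2.2) x = q3 at *
  obtain ⟨t1, t2, t3⟩ := ht
  have hn' : (n1 : ℂ) ^ 2 + (n2 : ℂ) ^ 2 = 1 := by exact_mod_cast hn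
  have hm : (mu : ℂ) ≠ 0 := by exact_mod_cast hmu.ne'
  have hl : (lam : ℂ) + 2 * mu ≠ 0 := by
    have : lam + 2 * mu ≠ 0 := by linarith
    exact_mod_cast this
  push_cast at t1 t2 t3
  generalize (n1 : ℂ) = n1 at *
  generalize (n2 : ℂ) = n2 at *
  have key : ∀ p q : ℂ, n2 * p = n1 * q → p = n1 * (n1 * p + n2 * q) ∧ q = n2 * (n1 * p + n2 * q) := by
    intro p q h
    constructor
    · linear_combination (-p) * hn' + n2 * h
    · linear_combination (-q) * hn' - n1 * h
  obtain ⟨c1, d1⟩ := key p1 q1 a1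
  obtain ⟨c2, d2⟩ := key p2 q2 a2
  obtain ⟨c3, d3⟩ := key p3 q3 a3
  generalize n1 * p1 + n2 * q1 = w1 at *
  generalize n1 * p2 + n2 * q2 = w2 at *
  generalize n1 * p3 + n2 * q3 = w3 at *
  subst c1 c2 c3 d1 d2 d3
  have t1' : mu * w1 + (lam + mu) * n1 * (n1 * w1 + n2 * w2) = 0 := by
    linear_combination t1 + (mu : ℂ) * w1 * hn'
  have t2' : mu * w2 + (lam + mu) * n2 * (n1 * w1 + n2 * w2) = 0 := by
    linear_combination t2 + (mu : ℂ) * w2 * hn'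
  have t3' : mu * w3 = 0 := by
    linear_combination t3 + (mu : ℂ) * w3 * hn'
  have hw : ((lam : ℂ) + 2 * mu) * (n1 * w1 + n2 * w2) = 0 := by
    linear_combination n1 * t1' + n2 * t2' - (lam + mu) * (n1 * w1 + n2 * w2) * hn'
  have hw0 := (mul_eq_zero.1 hw).resolve_left hl
  rw [hw0] at t1' t2'
  have z1 : w1 = 0 := by simpa [hm] using t1'
  have z2 : w2 = 0 := by simpa [hm] using t2'
  have z3 : w3 = 0 := by simpa [hm] using t3'
  simp [z1, z2, z3]

lemma lin_zero {G : Type*} [NormedAddCommGroup G] [NormedSpace ℝ G] (A : E3 →L[ℝ] G)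
    {c s c' s' : ℝ} (hd : c * s' - s * c' ≠ 0) (h1 : A ((c, s), 0) = 0) (h2 : A ((c', s'), 0) = 0)
    (h3 : A e3 = 0) : A = 0 := by
  refine ContinuousLinearMap.ext fun x => ?_
  set d := c * s' - s * c' with hdd
  have : x = ((x.1.1 * s' - x.1.2 * c') / d) • (((c, s), 0) : E3)
      + ((x.1.2 * c - x.1.1 * s) / d) • (((c', s'), 0) : E3) + x.2 • e3 := by
    ext
    · simp; field_simp; rw [hdd]; ring
    · simp; field_simp; rw [hdd]; ring
    · simp
  rw [this, map_add, map_add, map_smul, map_smul, map_smul, h1, h2, h3]; simp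

/-- On a face the full gradient of a component is zero once `qd1, qd2, qd3` are. -/
lemma fderiv_zero_of {g : E3 → ℂ} {x : E3} (hg : DifferentiableAt ℝ g x)
    (h1 : qd1 g x = 0) (h2 : qd2 g x = 0) (h3 : qd3 g x = 0) : fderiv ℝ g x = 0 := by
  rw [qd1_eq hg] at h1
  rw [qd2_eq hg] at h2
  rw [qd3_eq hg] at h3
  exact lin_zero _ (c := 1) (s := 0) (c' := 0) (s' := 1) (by norm_num) h1 h2 h3

/-- tangential derivatives on a face -/
lemma tang {g : E3 → ℂ} {c s r t h L : ℝ} (hr : r ∈ Ioo 0 h) (ht : t ∈ Ioo (-L) L)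
    (hg : DifferentiableAt ℝ g ((r * c, r * s), t))
    (hz : ∀ r : ℝ, 0 < r → r < h → ∀ t ∈ Ioo (-L) L, g ((r * c, r * s), t) = 0) :
    c * qd1 g ((r * c, r * s), t) + s * qd2 g ((r * c, r * s), t) = 0 ∧
      qd3 g ((r * c, r * s), t) = 0 := by
  rw [qd1_eq hg, qd2_eq hg, qd3_eq hg]
  constructor
  · have := (deriv_ray_zero (v := ((c, s), 0)) hg ?_).2
    · have e : (((c, s), 0) : E3) = c • e1 + s • e2 := by ext <;> simp
      rw [e, map_add, map_smul, map_smul] at this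
      simpa using this
    · filter_upwards [Ioo_mem_nhdsGT (sub_pos.2 hr.2)] with σ hσ
      have := hz (r + σ) (by linarith [hr.1, hσ.1]) (by linarith [hσ.2]) t ht
      convert this using 2
      ext <;> simp <;> ring
  · refine (deriv_ray_zero (v := e3) hg ?_).2
    filter_upwards [Ioo_mem_nhdsGT (sub_pos.2 ht.2)] with σ hσ
    have := hz r hr.1 hr.2 (t + σ) ⟨by linarith [ht.1, hσ.1], by linarith [hσ.2]⟩
    convert this using 2
    ext <;> simp

/-- all components have vanishing gradients on a face -/
lemma face (lam mu : ℝ) (hmu : 0 < mu) (hlam : 0 < 3 * lam + 2 * mu) (n1 n2 c s r t h L : ℝ)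
    (hn : n1 ^ 2 + n2 ^ 2 = 1) (hor : (n1 = s ∧ n2 = -c) ∨ (n1 = -s ∧ n2 = c))
    (u : E3 → ℂ × ℂ × ℂ)
    (hr : r ∈ Ioo 0 h) (ht : t ∈ Ioo (-L) L)
    (hg1 : DifferentiableAt ℝ (fun y => (u y).1) ((r * c, r * s), t))
    (hg2 : DifferentiableAt ℝ (fun y => (u y).2.1) ((r * c, r * s), t))
    (hg3 : DifferentiableAt ℝ (fun y => (u y).2.2) ((r * c, r * s), t))
    (hz : ∀ r : ℝ, 0 < r → r < h → ∀ t ∈ Ioo (-L) L, u ((r * c, r * s), t) = 0)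
    (htr : traction3 lam mu ((n1, n2), 0) u ((r * c, r * s), t) = 0) :
    fderiv ℝ (fun y => (u y).1) ((r * c, r * s), t) = 0 ∧
    fderiv ℝ (fun y => (u y).2.1) ((r * c, r * s), t) = 0 ∧
    fderiv ℝ (fun y => (u y).2.2) ((r * c, r * s), t) = 0 := by
  obtain ⟨a1, b1⟩ := tang hr ht hg1 (fun r h1 h2 t ht => by simp [hz r h1 h2 t ht])
  obtain ⟨a2, b2⟩ := tang hr ht hg2 (fun r h1 h2 t ht => by simp [hz r h1 h2 t ht])
  obtain ⟨a3, b3⟩ := tang hr ht hg3 (fun r h1 h2 t ht => by simp [hz r h1 h2 t ht])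
  have key : ∀ p q : ℂ, (c : ℂ) * p + s * q = 0 → (n2 : ℂ) * p = n1 * q := by
    intro p q h
    rcases hor with ⟨rfl, rfl⟩ | ⟨rfl, rfl⟩
    · push_cast; linear_combination -h
    · push_cast; linear_combination h
  obtain ⟨⟨x1, y1⟩, ⟨x2, y2⟩, x3, y3⟩ := trac_alg lam mu hmu hlam n1 n2 hn u _
    (key _ _ a1) (key _ _ a2) (key _ _ a3) b1 b2 b3 htr
  exact ⟨fderiv_zero_of hg1 x1 y1 b1, fderiv_zero_of hg2 x2 y2 b2, fderiv_zero_of hg3 x3 y3 b3⟩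

/-- second derivative vanishes at the origin -/
lemma D2_zero {g : E3 → ℂ} {O : Set E3} (hO : IsOpen O) (hg : ContDiffOn ℝ 2 g O)
    (h0 : (0 : E3) ∈ O) {c s c' s' ε : ℝ} (hε : 0 < ε) (hd : c * s' - s * c' ≠ 0)
    (hεO : ∀ t ∈ Ioo (-ε) ε, (((0, 0), t) : E3) ∈ O)
    (ha : ∀ r ∈ Ioo 0 ε, ∀ t ∈ Ioo (-ε) ε, fderiv ℝ g ((r * c, r * s), t) = 0)
    (hb : ∀ r ∈ Ioo 0 ε, ∀ t ∈ Ioo (-ε) ε, fderiv ℝ g ((r * c', r * s'), t) = 0) :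
    fderiv ℝ (fderiv ℝ g) 0 = 0 := by
  have hD : ∀ x ∈ O, DifferentiableAt ℝ (fderiv ℝ g) x := fun x hx =>
    ((cd_fderiv hO hg).contDiffAt (hO.mem_nhds hx)).differentiableAt (by norm_num)
  have ax : ∀ t ∈ Ioo (-ε) ε, fderiv ℝ g ((0, 0), t) = 0 := by
    intro t ht
    refine (deriv_ray_zero (v := ((c, s), 0)) (hD _ (hεO t ht)) ?_).1
    filter_upwards [Ioo_mem_nhdsGT hε] with σ hσ
    simpa using ha σ hσ t ht
  have z : (0 : ℝ) ∈ Ioo (-ε) ε := ⟨by linarith, hε⟩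
  refine lin_zero _ hd ?_ ?_ ?_
  · refine (deriv_ray_zero (hD _ h0) ?_).2
    filter_upwards [Ioo_mem_nhdsGT hε] with σ hσ
    simpa using ha σ hσ 0 z
  · refine (deriv_ray_zero (hD _ h0) ?_).2
    filter_upwards [Ioo_mem_nhdsGT hε] with σ hσ
    simpa using hb σ hσ 0 z
  · refine (deriv_ray_zero (hD _ h0) ?_).2
    filter_upwards [Ioo_mem_nhdsGT hε] with σ hσ
    simpa using ax σ ⟨by linarith [hσ.1], hσ.2⟩

/-- The Lamé operator in terms of second Fréchet derivatives tends to zero at the origin. -/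
lemma Lame_tendsto (lam mu : ℝ) {u : E3 → ℂ × ℂ × ℂ} {O : Set E3} (hO : IsOpen O)
    (h0 : (0 : E3) ∈ O)
    (hg1 : ContDiffOn ℝ 2 (fun y => (u y).1) O)
    (hg2 : ContDiffOn ℝ 2 (fun y => (u y).2.1) O)
    (hg3 : ContDiffOn ℝ 2 (fun y => (u y).2.2) O)
    (z1 : fderiv ℝ (fderiv ℝ (fun y => (u y).1)) 0 = 0)
    (z2 : fderiv ℝ (fderiv ℝ (fun y => (u y).2.1)) 0 = 0)
    (z3 : fderiv ℝ (fderiv ℝ (fun y => (u y).2.2)) 0 = 0) :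
    Tendsto (Lame3 lam mu u) (𝓝 0) (𝓝 0) := by
  have q1 : ∀ (g : E3 → ℂ), ContDiffOn ℝ 2 g O → ∀ x ∈ O,
    HasFDerivAt (qd1 g) ((fderiv ℝ (fderiv ℝ g) x).flip e1) x := fun g hg x hx =>
      qd_hasFDeriv hO hg (fun _ h => qd1_eq h) hx
  have q2 : ∀ (g : E3 → ℂ), ContDiffOn ℝ 2 g O → ∀ x ∈ O,
    HasFDerivAt (qd2 g) ((fderiv ℝ (fderiv ℝ g) x).flip e2) x := fun g hg x hx =>
      qd_hasFDeriv hO hg (fun _ h => qd2_eq h) hx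
  have q3 : ∀ (g : E3 → ℂ), ContDiffOn ℝ 2 g O → ∀ x ∈ O,
    HasFDerivAt (qd3 g) ((fderiv ℝ (fderiv ℝ g) x).flip e3) x := fun g hg x hx =>
      qd_hasFDeriv hO hg (fun _ h => qd3_eq h) hx
  have hdiv : ∀ x ∈ O, HasFDerivAt (div3 u)
      ((fderiv ℝ (fderiv ℝ (fun y => (u y).1)) x).flip e1
        + (fderiv ℝ (fderiv ℝ (fun y => (u y).2.1)) x).flip e2
        + (fderiv ℝ (fderiv ℝ (fun y => (u y).2.2)) x).flip e3) x := fun x hx =>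
    ((q1 _ hg1 x hx).add (q2 _ hg2 x hx)).add (q3 _ hg3 x hx)
  have T1 := D2_tendsto hO hg1 h0 z1
  have T2 := D2_tendsto hO hg2 h0 z2
  have T3 := D2_tendsto hO hg3 h0 z3
  have r1 : ∀ (g : E3 → ℂ), ContDiffOn ℝ 2 g O → ∀ x ∈ O,
      qd1 (qd1 g) x = fderiv ℝ (fderiv ℝ g) x e1 e1 := fun g hg x hx => by
    rw [qd1_eq (q1 g hg x hx).differentiableAt, (q1 g hg x hx).fderiv]; rfl
  have r2 : ∀ (g : E3 → ℂ), ContDiffOn ℝ 2 g O → ∀ x ∈ O,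
      qd2 (qd2 g) x = fderiv ℝ (fderiv ℝ g) x e2 e2 := fun g hg x hx => by
    rw [qd2_eq (q2 g hg x hx).differentiableAt, (q2 g hg x hx).fderiv]; rfl
  have r3 : ∀ (g : E3 → ℂ), ContDiffOn ℝ 2 g O → ∀ x ∈ O,
      qd3 (qd3 g) x = fderiv ℝ (fderiv ℝ g) x e3 e3 := fun g hg x hx => by
    rw [qd3_eq (q3 g hg x hx).differentiableAt, (q3 g hg x hx).fderiv]; rfl
  have lap : ∀ (g : E3 → ℂ), ContDiffOn ℝ 2 g O → fderiv ℝ (fderiv ℝ g) 0 = 0 →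
      Tendsto (fun x => qd1 (qd1 g) x + qd2 (qd2 g) x + qd3 (qd3 g) x) (𝓝 0) (𝓝 0) := by
    intro g hg hz
    have T := D2_tendsto hO hg h0 hz
    have := ((T e1 e1).add (T e2 e2)).add (T e3 e3)
    simp only [add_zero] at this
    refine this.congr' ?_
    filter_upwards [hO.mem_nhds h0] with x hx
    rw [r1 g hg x hx, r2 g hg x hx, r3 g hg x hx]
  have dv : ∀ (v : E3), Tendsto (fun x => fderiv ℝ (div3 u) x v) (𝓝 0) (𝓝 0) := by
    intro v
    have := ((T1 v e1).add (T2 v e2)).add (T3 v e3)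
    simp only [add_zero] at this
    refine this.congr' ?_
    filter_upwards [hO.mem_nhds h0] with x hx
    rw [(hdiv x hx).fderiv]; rfl
  have d1 : Tendsto (qd1 (div3 u)) (𝓝 0) (𝓝 0) := (dv e1).congr' (by
    filter_upwards [hO.mem_nhds h0] with x hx
    exact (qd1_eq (hdiv x hx).differentiableAt).symm)
  have d2 : Tendsto (qd2 (div3 u)) (𝓝 0) (𝓝 0) := (dv e2).congr' (by
    filter_upwards [hO.mem_nhds h0] with x hx
    exact (qd2_eq (hdiv x hx).differentiableAt).symm)
  have d3 : Tendsto (qd3 (div3 u)) (𝓝 0) (𝓝 0) := (dv e3).congr' (by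
    filter_upwards [hO.mem_nhds h0] with x hx
    exact (qd3_eq (hdiv x hx).differentiableAt).symm)
  have comb : ∀ (a b : E3 → ℂ), Tendsto a (𝓝 0) (𝓝 0) → Tendsto b (𝓝 0) (𝓝 0) →
      Tendsto (fun x => (lam : ℂ) * a x + ((lam : ℂ) + (mu : ℂ)) * b x) (𝓝 0) (𝓝 0) := by
    intro a b ha hb
    simpa using (ha.const_mul (lam : ℂ)).add (hb.const_mul ((lam : ℂ) + (mu : ℂ)))
  exact (comb _ _ (lap _ hg1 z1) d1).prodMk_nhds
    ((comb _ _ (lap _ hg2 z2) d2).prodMk_nhds (comb _ _ (lap _ hg3 z3) d3))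

theorem stmt_14 (lam mu α θm θM h L : ℝ)
    (hmu : 0 < mu) (hlam : 0 < 3 * lam + 2 * mu) (hα : 0 < α) (hα' : α < 1)
    (h1 : -π < θm) (h2 : θm < θM) (h3 : θM < π) (hangle : θM ≠ θm + π)
    (hh : 0 < h) (hL : 0 < L)
    (f : (ℝ × ℝ) × ℝ → ℂ × ℂ × ℂ)
    (hf : ∃ C : ℝ, 0 ≤ C ∧
      ∀ x ∈ closure ((sector θm θM ∩ disc h) ×ˢ Set.Ioo (-L) L),
      ∀ y ∈ closure ((sector θm θM ∩ disc h) ×ˢ Set.Ioo (-L) L),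
        ‖f x - f y‖ ≤ C * Real.sqrt ((x.1.1 - y.1.1) ^ 2 + (x.1.2 - y.1.2) ^ 2
          + (x.2 - y.2) ^ 2) ^ α)
    (u : (ℝ × ℝ) × ℝ → ℂ × ℂ × ℂ) (O : Set ((ℝ × ℝ) × ℝ)) (hO : IsOpen O)
    (hsub : closure ((sector θm θM ∩ disc h) ×ˢ Set.Ioo (-L) L) ⊆ O)
    (hu : ContDiffOn ℝ 2 u O)
    (heq : ∀ x ∈ (sector θm θM ∩ disc h) ×ˢ Set.Ioo (-L) L, Lame3 lam mu u x = f x)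
    (hbd : ∀ r : ℝ, 0 < r → r < h → ∀ t ∈ Set.Ioo (-L) L,
      u ((r * Real.cos θm, r * Real.sin θm), t) = 0 ∧
      traction3 lam mu ((Real.sin θm, -Real.cos θm), 0) u
        ((r * Real.cos θm, r * Real.sin θm), t) = 0 ∧
      u ((r * Real.cos θM, r * Real.sin θM), t) = 0 ∧
      traction3 lam mu ((-Real.sin θM, Real.cos θM), 0) u
        ((r * Real.cos θM, r * Real.sin θM), t) = 0) :
    f ((0, 0), 0) = 0 := by
  -- points of `Q` approaching the origin
  set θ := (θm + θM) / 2 with hθ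
  let p : ℝ → E3 := fun r => ((r * Real.cos θ, r * Real.sin θ), 0)
  have hpQ : ∀ᶠ r in 𝓝[>] (0 : ℝ), p r ∈ (sector θm θM ∩ disc h) ×ˢ Set.Ioo (-L) L := by
    filter_upwards [Ioo_mem_nhdsGT hh] with r hr
    have e : (((r * Real.cos θ : ℝ) : ℂ) + ((r * Real.sin θ : ℝ) : ℂ) * Complex.I)
        = (r : ℂ) * (Complex.cos θ + Complex.sin θ * Complex.I) := by push_cast; ring
    have harg : ((r : ℂ) * (Complex.cos θ + Complex.sin θ * Complex.I)).arg = θ :=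
      Complex.arg_mul_cos_add_sin_mul_I hr.1 ⟨by linarith, by linarith⟩
    have hnorm : ‖(r : ℂ) * (Complex.cos θ + Complex.sin θ * Complex.I)‖ = r := by
      rw [norm_mul, Complex.norm_cos_add_sin_mul_I, mul_one, Complex.norm_real,
        Real.norm_of_nonneg hr.1.le]
    refine ⟨⟨⟨?_, ?_, ?_⟩, ?_⟩, ?_⟩
    · rw [e, ← norm_ne_zero_iff, hnorm]; exact hr.1.ne'
    · rw [e, harg]; linarith
    · rw [e, harg]; linarith
    · change ‖_‖ < h
      rw [e, hnorm]; exact hr.2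
    · exact ⟨neg_lt_zero.2 hL, hL⟩
  have hpt : Tendsto p (𝓝[>] 0) (𝓝 0) := by
    have : Continuous p := by fun_prop
    have := this.tendsto 0
    have e : p 0 = 0 := by ext <;> simp [p]
    rw [e] at this
    exact this.mono_left nhdsWithin_le_nhds
  have h0cl : (0 : E3) ∈ closure ((sector θm θM ∩ disc h) ×ˢ Set.Ioo (-L) L) :=
    mem_closure_of_tendsto hpt hpQ
  have h0 : (0 : E3) ∈ O := hsub h0cl
  have hg1 : ContDiffOn ℝ 2 (fun y => (u y).1) O := contDiff_fst.comp_contDiffOn hu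
  have hg23 : ContDiffOn ℝ 2 (fun y => (u y).2) O := contDiff_snd.comp_contDiffOn hu
  have hg2 : ContDiffOn ℝ 2 (fun y => (u y).2.1) O := contDiff_fst.comp_contDiffOn hg23
  have hg3 : ContDiffOn ℝ 2 (fun y => (u y).2.2) O := contDiff_snd.comp_contDiffOn hg23
  obtain ⟨δ, hδ, hball⟩ := Metric.isOpen_iff.1 hO 0 h0
  obtain ⟨ε, hε, hεh, hεL, hεδ⟩ : ∃ ε : ℝ, 0 < ε ∧ ε ≤ h ∧ ε ≤ L ∧ ε ≤ δ :=
    ⟨min h (min L δ), by positivity, min_le_left _ _,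
      (min_le_right _ _).trans (min_le_left _ _), (min_le_right _ _).trans (min_le_right _ _)⟩
  have hmem : ∀ φ r t : ℝ, 0 ≤ r → r < ε → t ∈ Ioo (-ε) ε →
      (((r * Real.cos φ, r * Real.sin φ), t) : E3) ∈ O := by
    intro φ r t hr0 hr ht
    apply hball
    rw [mem_ball_zero_iff]
    simp only [Prod.norm_def, max_lt_iff, norm_mul, Real.norm_eq_abs, abs_of_nonneg hr0]
    have a := mul_le_mul_of_nonneg_left (Real.abs_cos_le_one φ) hr0
    have b := mul_le_mul_of_nonneg_left (Real.abs_sin_le_one φ) hr0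
    have c := abs_lt.2 ht
    refine ⟨⟨?_, ?_⟩, ?_⟩ <;> linarith
  have fm : ∀ r ∈ Ioo 0 ε, ∀ t ∈ Ioo (-ε) ε, _ := fun r hr t ht =>
    have hO' := hmem θm r t hr.1.le hr.2 ht
    have ht' : t ∈ Ioo (-L) L := ⟨by linarith [ht.1], by linarith [ht.2]⟩
    have hr' : r ∈ Ioo 0 h := ⟨hr.1, by linarith [hr.2]⟩
    face lam mu hmu hlam (Real.sin θm) (-Real.cos θm) (Real.cos θm) (Real.sin θm) r t h L
      (by rw [neg_sq]; exact Real.sin_sq_add_cos_sq θm) (Or.inl ⟨rfl, rfl⟩) u hr' ht'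
      (diffAt_of hO hg1 hO') (diffAt_of hO hg2 hO') (diffAt_of hO hg3 hO')
      (fun r a b t c => (hbd r a b t c).1) (hbd r hr'.1 hr'.2 t ht').2.1
  have fM : ∀ r ∈ Ioo 0 ε, ∀ t ∈ Ioo (-ε) ε, _ := fun r hr t ht =>
    have hO' := hmem θM r t hr.1.le hr.2 ht
    have ht' : t ∈ Ioo (-L) L := ⟨by linarith [ht.1], by linarith [ht.2]⟩
    have hr' : r ∈ Ioo 0 h := ⟨hr.1, by linarith [hr.2]⟩
    face lam mu hmu hlam (-Real.sin θM) (Real.cos θM) (Real.cos θM) (Real.sin θM) r t h L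
      (by rw [neg_sq]; exact Real.sin_sq_add_cos_sq θM) (Or.inr ⟨rfl, rfl⟩) u hr' ht'
      (diffAt_of hO hg1 hO') (diffAt_of hO hg2 hO') (diffAt_of hO hg3 hO')
      (fun r a b t c => (hbd r a b t c).2.2.1) (hbd r hr'.1 hr'.2 t ht').2.2.2
  have hd : Real.cos θm * Real.sin θM - Real.sin θm * Real.cos θM ≠ 0 := by
    have e : Real.cos θm * Real.sin θM - Real.sin θm * Real.cos θM = Real.sin (θM - θm) := by
      rw [Real.sin_sub]; ring
    rw [e]
    intro hs
    rcases lt_trichotomy (θM - θm) π with hlt | heq' | hgt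
    · exact (Real.sin_pos_of_pos_of_lt_pi (by linarith) hlt).ne' hs
    · exact hangle (by linarith)
    · have : Real.sin (θM - θm - π) = 0 := by rw [Real.sin_sub_pi, hs, neg_zero]
      exact (Real.sin_pos_of_pos_of_lt_pi (by linarith) (by linarith)).ne' this
  have hax : ∀ t ∈ Ioo (-ε) ε, (((0, 0), t) : E3) ∈ O := fun t ht => by
    simpa using hmem 0 0 t le_rfl hε ht
  have z1 := D2_zero hO hg1 h0 hε hd hax (fun r hr t ht => (fm r hr t ht).1)
    (fun r hr t ht => (fM r hr t ht).1)
  have z2 := D2_zero hO hg2 h0 hε hd hax (fun r hr t ht => (fm r hr t ht).2.1)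
    (fun r hr t ht => (fM r hr t ht).2.1)
  have z3 := D2_zero hO hg3 h0 hε hd hax (fun r hr t ht => (fm r hr t ht).2.2)
    (fun r hr t ht => (fM r hr t ht).2.2)
  have hT := (Lame_tendsto lam mu hO h0 hg1 hg2 hg3 z1 z2 z3).comp hpt
  have hfT : Tendsto (fun r => f (p r)) (𝓝[>] 0) (𝓝 0) := hT.congr' (by
    filter_upwards [hpQ] with r hr
    exact heq _ hr)
  obtain ⟨C, hC, hf⟩ := hf
  have hfT' : Tendsto (fun r => f (p r)) (𝓝[>] 0) (𝓝 (f 0)) := by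
    rw [tendsto_iff_norm_sub_tendsto_zero]
    have hcont : Continuous (fun x : E3 => C * Real.sqrt ((x.1.1 - (0 : E3).1.1) ^ 2
        + (x.1.2 - (0 : E3).1.2) ^ 2 + (x.2 - (0 : E3).2) ^ 2) ^ α) := by
      refine continuous_const.mul (Continuous.rpow_const (by fun_prop) (fun _ => Or.inr hα.le))
    have hlim := (hcont.tendsto 0).comp hpt
    have hzero : C * Real.sqrt (((0 : E3).1.1 - (0 : E3).1.1) ^ 2
        + ((0 : E3).1.2 - (0 : E3).1.2) ^ 2 + ((0 : E3).2 - (0 : E3).2) ^ 2) ^ α = 0 := by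
      simp [Real.zero_rpow hα.ne']
    rw [hzero] at hlim
    refine tendsto_of_tendsto_of_tendsto_of_le_of_le' tendsto_const_nhds hlim
      (Eventually.of_forall fun _ => norm_nonneg _) ?_
    filter_upwards [hpQ] with r hr
    exact hf _ (subset_closure hr) _ h0cl
  exact tendsto_nhds_unique hfT' hfT
end
end

section
/- Let λ, μ ∈ ℝ with μ > 0 and 2λ + 2μ > 0, let ω > 0 and α ∈ (0,1). Let −π < θ_m < θ_M < π with θ_M ≠ θ_m + π, let K be the open planar sector with angles θ_m, θ_M, h > 0 and B = B(0,h). Let V : ℝ² → ℝ be α-Hölder continuous on the closure of K ∩ B, and let v, w : ℝ² → ℂ² be twice continuously differentiable on an open neighbourhood of the closure of K ∩ B, satisfying pointwise on K ∩ B the transmission eigenfunction equations λΔw + (λ+μ)∇(∇·w) + ω²w = 0 and λΔv + (λ+μ)∇(∇·v) + ω²(1+V)v = 0. Suppose v = w and T_ν v = T_ν w at every point of the two open radial boundary segments Σ (with ν the outward unit normal of K). If V(0) ≠ 0, then v(0) = w(0) = 0; that is, the transmission eigenfunctions vanish at the corner. -/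
noncomputable section

open Complex MeasureTheory Real Set

open Filter Topology

lemma aux_pd1 {F : ℝ × ℝ → ℂ} {x : ℝ × ℝ} (h : DifferentiableAt ℝ F x) :
    HasDerivAt (fun t => F (t, x.2)) (pd1 F x) x.1 ∧ pd1 F x = fderiv ℝ F x (1, 0) := by
  have h1 : HasDerivAt (fun t : ℝ => (t, x.2)) ((1 : ℝ), (0 : ℝ)) x.1 :=
    (hasDerivAt_id x.1).prodMk (hasDerivAt_const x.1 x.2)
  have h2 : HasFDerivAt F (fderiv ℝ F x) ((fun t : ℝ => (t, x.2)) x.1) := h.hasFDerivAt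
  have h3 := h2.comp_hasDerivAt x.1 h1
  have h4 : pd1 F x = fderiv ℝ F x (1, 0) := h3.deriv
  exact ⟨by rw [h4]; exact h3, h4⟩

lemma aux_pd2 {F : ℝ × ℝ → ℂ} {x : ℝ × ℝ} (h : DifferentiableAt ℝ F x) :
    HasDerivAt (fun t => F (x.1, t)) (pd2 F x) x.2 ∧ pd2 F x = fderiv ℝ F x (0, 1) := by
  have h1 : HasDerivAt (fun t : ℝ => (x.1, t)) ((0 : ℝ), (1 : ℝ)) x.2 :=
    (hasDerivAt_const x.2 x.1).prodMk (hasDerivAt_id x.2)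
  have h2 : HasFDerivAt F (fderiv ℝ F x) ((fun t : ℝ => (x.1, t)) x.2) := h.hasFDerivAt
  have h3 := h2.comp_hasDerivAt x.2 h1
  have h4 : pd2 F x = fderiv ℝ F x (0, 1) := h3.deriv
  exact ⟨by rw [h4]; exact h3, h4⟩

lemma aux_cd {F : ℝ × ℝ → ℂ} {O : Set (ℝ × ℝ)} (hO : IsOpen O) {n : WithTop ℕ∞}
    (h : ContDiffOn ℝ (n + 1) F O) : ContDiffOn ℝ n (pd1 F) O ∧ ContDiffOn ℝ n (pd2 F) O := by
  have hd : ∀ x ∈ O, DifferentiableAt ℝ F x := fun x hx =>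
    (h.contDiffAt (hO.mem_nhds hx)).differentiableAt (by simp)
  have hf : ContDiffOn ℝ n (fderiv ℝ F) O := h.fderiv_of_isOpen hO le_rfl
  exact ⟨(hf.clm_apply contDiffOn_const).congr fun x hx => (aux_pd1 (hd x hx)).2,
    (hf.clm_apply contDiffOn_const).congr fun x hx => (aux_pd2 (hd x hx)).2⟩

lemma aux_diff {F : ℝ × ℝ → ℂ} {O : Set (ℝ × ℝ)} (hO : IsOpen O)
    (h : ContDiffOn ℝ 1 F O) {x : ℝ × ℝ} (hx : x ∈ O) : DifferentiableAt ℝ F x :=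
  (h.contDiffAt (hO.mem_nhds hx)).differentiableAt (by simp)

lemma aux_congr {F G : ℝ × ℝ → ℂ} {O : Set (ℝ × ℝ)} (hO : IsOpen O)
    (h : ∀ x ∈ O, F x = G x) {x : ℝ × ℝ} (hx : x ∈ O) :
    pd1 F x = pd1 G x ∧ pd2 F x = pd2 G x := by
  constructor
  · apply Filter.EventuallyEq.deriv_eq
    have : Continuous fun t : ℝ => (t, x.2) := by fun_prop
    filter_upwards [(hO.preimage this).mem_nhds (show x.1 ∈ _ from hx)] with t ht
    exact h _ ht
  · apply Filter.EventuallyEq.deriv_eq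
    have : Continuous fun t : ℝ => (x.1, t) := by fun_prop
    filter_upwards [(hO.preimage this).mem_nhds (show x.2 ∈ _ from hx)] with t ht
    exact h _ ht

lemma aux_lin {F G H K : ℝ × ℝ → ℂ} (a b c d : ℂ) {x : ℝ × ℝ} (hF : DifferentiableAt ℝ F x)
    (hG : DifferentiableAt ℝ G x) (hH : DifferentiableAt ℝ H x) (hK : DifferentiableAt ℝ K x) :
    pd1 (fun y => a * F y + b * G y + c * H y + d * K y) x
      = a * pd1 F x + b * pd1 G x + c * pd1 H x + d * pd1 K x ∧
    pd2 (fun y => a * F y + b * G y + c * H y + d * K y) x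
      = a * pd2 F x + b * pd2 G x + c * pd2 H x + d * pd2 K x :=
  ⟨((((aux_pd1 hF).1.const_mul a).add ((aux_pd1 hG).1.const_mul b)).add
      ((aux_pd1 hH).1.const_mul c) |>.add ((aux_pd1 hK).1.const_mul d)).deriv,
   ((((aux_pd2 hF).1.const_mul a).add ((aux_pd2 hG).1.const_mul b)).add
      ((aux_pd2 hH).1.const_mul c) |>.add ((aux_pd2 hK).1.const_mul d)).deriv⟩

lemma aux_sub {F G : ℝ × ℝ → ℂ} {x : ℝ × ℝ} (hF : DifferentiableAt ℝ F x)
    (hG : DifferentiableAt ℝ G x) :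
    pd1 (fun y => F y - G y) x = pd1 F x - pd1 G x ∧
    pd2 (fun y => F y - G y) x = pd2 F x - pd2 G x :=
  ⟨((aux_pd1 hF).1.sub (aux_pd1 hG).1).deriv, ((aux_pd2 hF).1.sub (aux_pd2 hG).1).deriv⟩

lemma aux_rayO {O : Set (ℝ × ℝ)} (hO : IsOpen O) (h0 : ((0 : ℝ), (0 : ℝ)) ∈ O) (c s : ℝ) :
    ∀ᶠ r : ℝ in 𝓝[>] 0, (r * c, r * s) ∈ O := by
  have : Continuous fun r : ℝ => (r * c, r * s) := by fun_prop
  apply mem_nhdsWithin_of_mem_nhds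
  exact (hO.preimage this).mem_nhds (by simpa using h0)

lemma aux_ray {F : ℝ × ℝ → ℂ} {O : Set (ℝ × ℝ)} (hO : IsOpen O) (h0 : ((0 : ℝ), (0 : ℝ)) ∈ O)
    (h : ContDiffOn ℝ 1 F O) (c s : ℝ) (hz : ∀ᶠ r : ℝ in 𝓝[>] 0, F (r * c, r * s) = 0) :
    ∀ᶠ r : ℝ in 𝓝[>] 0,
      (c : ℂ) * pd1 F (r * c, r * s) + (s : ℂ) * pd2 F (r * c, r * s) = 0 := by
  filter_upwards [eventually_eventually_nhdsWithin.2 hz, aux_rayO hO h0 c s,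
    self_mem_nhdsWithin] with r hr hrO hr0
  rw [nhdsWithin_eq_nhds.2 (Ioi_mem_nhds hr0)] at hr
  have hd := aux_diff hO h hrO
  have h1 : HasDerivAt (fun r : ℝ => (r * c, r * s)) (1 * c, 1 * s) r :=
    ((hasDerivAt_id r).mul_const c).prodMk ((hasDerivAt_id r).mul_const s)
  have h2 : HasFDerivAt F (fderiv ℝ F (r * c, r * s)) ((fun r : ℝ => (r * c, r * s)) r) :=
    hd.hasFDerivAt
  have h3 := (h2.comp_hasDerivAt r h1).deriv
  have h4 : deriv (F ∘ fun r : ℝ => (r * c, r * s)) r = 0 := by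
    have : (F ∘ fun r : ℝ => (r * c, r * s)) =ᶠ[𝓝 r] fun _ => (0 : ℂ) := hr
    rw [this.deriv_eq]; simp
  rw [h4] at h3
  rw [(aux_pd1 hd).2, (aux_pd2 hd).2]
  have : ((1 * c, 1 * s) : ℝ × ℝ) = c • ((1 : ℝ), (0 : ℝ)) + s • ((0 : ℝ), (1 : ℝ)) := by
    simp
  rw [this, map_add, map_smul, map_smul] at h3
  simpa using h3.symm

lemma aux_zero {F : ℝ × ℝ → ℂ} (hF : ContinuousAt F (0, 0)) (c s : ℝ)
    (hz : ∀ᶠ r : ℝ in 𝓝[>] 0, F (r * c, r * s) = 0) : F (0, 0) = 0 := by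
  have h1 : Tendsto (fun r : ℝ => (r * c, r * s)) (𝓝[>] 0) (𝓝 (0, 0)) := by
    have : Continuous fun r : ℝ => (r * c, r * s) := by fun_prop
    have := this.tendsto 0
    simp only [zero_mul] at this
    exact this.mono_left nhdsWithin_le_nhds
  have h2 := hF.tendsto.comp h1
  have h3 : Tendsto (F ∘ fun r : ℝ => (r * c, r * s)) (𝓝[>] 0) (𝓝 0) :=
    tendsto_const_nhds.congr' (by filter_upwards [hz] with r hr using hr.symm)
  exact tendsto_nhds_unique h2 h3

lemma aux_ray0 {F : ℝ × ℝ → ℂ} {O : Set (ℝ × ℝ)} (hO : IsOpen O) (h0 : ((0 : ℝ), (0 : ℝ)) ∈ O)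
    (h : ContDiffOn ℝ 1 F O) (c s : ℝ) (hz : ∀ᶠ r : ℝ in 𝓝[>] 0, F (r * c, r * s) = 0) :
    (c : ℂ) * pd1 F (0, 0) + (s : ℂ) * pd2 F (0, 0) = 0 := by
  have hcd := aux_cd (n := 0) hO (by simpa using h)
  have c1 := hcd.1.continuousOn.continuousAt (hO.mem_nhds h0)
  have c2 := hcd.2.continuousOn.continuousAt (hO.mem_nhds h0)
  exact aux_zero (F := fun x => (c : ℂ) * pd1 F x + (s : ℂ) * pd2 F x)
    ((continuousAt_const.mul c1).add (continuousAt_const.mul c2)) c s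
    (aux_ray hO h0 h c s hz)

lemma aux_symm {F : ℝ × ℝ → ℂ} {O : Set (ℝ × ℝ)} (hO : IsOpen O)
    (h : ContDiffOn ℝ 2 F O) {x : ℝ × ℝ} (hx : x ∈ O) : pd2 (pd1 F) x = pd1 (pd2 F) x := by
  have hs : IsSymmSndFDerivAt ℝ F x :=
    (h.contDiffAt (hO.mem_nhds hx)).isSymmSndFDerivAt (by simp)
  have hd : ∀ x ∈ O, DifferentiableAt ℝ F x := fun x hx => 
    aux_diff hO (h.of_le (by norm_num)) hx
  have hf : ContDiffOn ℝ 1 (fderiv ℝ F) O := h.fderiv_of_isOpen hO (by norm_num)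
  have hfd : DifferentiableAt ℝ (fderiv ℝ F) x :=
    (hf.contDiffAt (hO.mem_nhds hx)).differentiableAt (by simp)
  have e1 : ∀ e : ℝ × ℝ, HasFDerivAt (fun y => fderiv ℝ F y e)
      ((fderiv ℝ (fderiv ℝ F) x).flip e) x := fun e => by
    have := hfd.hasFDerivAt.clm_apply (hasFDerivAt_const e x)
    simpa using this
  rw [(aux_congr hO (fun y hy => (aux_pd1 (hd y hy)).2) hx).2,
    (aux_congr hO (fun y hy => (aux_pd2 (hd y hy)).2) hx).1,
    (aux_pd2 (e1 _).differentiableAt).2, (aux_pd1 (e1 _).differentiableAt).2,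
    (e1 _).fderiv, (e1 _).fderiv]
  exact hs _ _

/-- Cauchy data vanishing on one ray kills the Hessian in that direction at the corner. -/
lemma aux_one (lam mu : ℝ) (hmu : 0 < mu) (hlam : 0 < 2 * lam + 2 * mu)
    {f g : ℝ × ℝ → ℂ} {O : Set (ℝ × ℝ)} (hO : IsOpen O) (h0 : ((0 : ℝ), (0 : ℝ)) ∈ O)
    (hf : ContDiffOn ℝ 2 f O) (hg : ContDiffOn ℝ 2 g O) (c s n1 n2 : ℝ)
    (hcs : c ^ 2 + s ^ 2 = 1) (hn : n1 = s ∧ n2 = -c ∨ n1 = -s ∧ n2 = c)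
    (zf : ∀ᶠ r : ℝ in 𝓝[>] 0, f (r * c, r * s) = 0)
    (zg : ∀ᶠ r : ℝ in 𝓝[>] 0, g (r * c, r * s) = 0)
    (zt : ∀ᶠ r : ℝ in 𝓝[>] 0,
      traction lam mu (n1, n2) (fun x => (f x, g x)) (r * c, r * s) = 0) :
    ((c : ℂ) * pd1 (pd1 f) (0, 0) + (s : ℂ) * pd1 (pd2 f) (0, 0) = 0 ∧
     (c : ℂ) * pd1 (pd2 f) (0, 0) + (s : ℂ) * pd2 (pd2 f) (0, 0) = 0) ∧
    ((c : ℂ) * pd1 (pd1 g) (0, 0) + (s : ℂ) * pd1 (pd2 g) (0, 0) = 0 ∧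
     (c : ℂ) * pd1 (pd2 g) (0, 0) + (s : ℂ) * pd2 (pd2 g) (0, 0) = 0) := by
  obtain ⟨f1, f2⟩ := aux_cd (n := 1) hO (by simpa [one_add_one_eq_two] using hf)
  obtain ⟨g1, g2⟩ := aux_cd (n := 1) hO (by simpa [one_add_one_eq_two] using hg)
  have df1 := aux_diff hO f1 h0
  have df2 := aux_diff hO f2 h0
  have dg1 := aux_diff hO g1 h0
  have dg2 := aux_diff hO g2 h0
  have key : ∀ a b p q : ℂ,
      (∀ᶠ r : ℝ in 𝓝[>] 0, a * pd1 f (r * c, r * s) + b * pd2 f (r * c, r * s)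
        + p * pd1 g (r * c, r * s) + q * pd2 g (r * c, r * s) = 0) →
      (c : ℂ) * (a * pd1 (pd1 f) (0, 0) + b * pd1 (pd2 f) (0, 0)
        + p * pd1 (pd1 g) (0, 0) + q * pd1 (pd2 g) (0, 0)) +
      (s : ℂ) * (a * pd1 (pd2 f) (0, 0) + b * pd2 (pd2 f) (0, 0)
        + p * pd1 (pd2 g) (0, 0) + q * pd2 (pd2 g) (0, 0)) = 0 := by
    intro a b p q hz
    have := aux_ray0 (F := fun y => a * pd1 f y + b * pd2 f y + p * pd1 g y + q * pd2 g y) hO h0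
      ((((contDiffOn_const.mul f1).add (contDiffOn_const.mul f2)).add
        (contDiffOn_const.mul g1)).add (contDiffOn_const.mul g2)) c s hz
    rw [(aux_lin a b p q df1 df2 dg1 dg2).1, (aux_lin a b p q df1 df2 dg1 dg2).2,
      aux_symm hO hf h0, aux_symm hO hg h0] at this
    exact this
  have k1 := key c s 0 0 (by
    filter_upwards [aux_ray hO h0 (hf.of_le (by norm_num)) c s zf] with r hr
    linear_combination hr)
  have k2 := key 0 0 c s (by
    filter_upwards [aux_ray hO h0 (hg.of_le (by norm_num)) c s zg] with r hr
    linear_combination hr)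
  have k3 := key ((2 * mu + lam) * n1) (mu * n2) (mu * n2) (lam * n1) (by
    filter_upwards [zt] with r hr
    have := congrArg Prod.fst hr
    simp only [traction, Prod.fst_zero] at this
    linear_combination this)
  have k4 := key (lam * n2) (mu * n1) (mu * n1) ((2 * mu + lam) * n2) (by
    filter_upwards [zt] with r hr
    have := congrArg Prod.snd hr
    simp only [traction, Prod.snd_zero] at this
    linear_combination this)
  generalize pd1 (pd1 f) (0, 0) = f11 at *
  generalize pd1 (pd2 f) (0, 0) = f12 at *
  generalize pd2 (pd2 f) (0, 0) = f22 at *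
  generalize pd1 (pd1 g) (0, 0) = g11 at *
  generalize pd1 (pd2 g) (0, 0) = g12 at *
  generalize pd2 (pd2 g) (0, 0) = g22 at *
  have hcs' : (c : ℂ) ^ 2 + (s : ℂ) ^ 2 = 1 := by exact_mod_cast hcs
  obtain ⟨A1, hA1⟩ : ∃ A1, A1 = c * f11 + s * f12 := ⟨_, rfl⟩
  obtain ⟨A2, hA2⟩ : ∃ A2, A2 = c * f12 + s * f22 := ⟨_, rfl⟩
  obtain ⟨B1, hB1⟩ : ∃ B1, B1 = c * g11 + s * g12 := ⟨_, rfl⟩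
  obtain ⟨B2, hB2⟩ : ∃ B2, B2 = c * g12 + s * g22 := ⟨_, rfl⟩
  rw [← hA1, ← hA2, ← hB1, ← hB2]
  have j1 : c * A1 + s * A2 = 0 := by rw [hA1, hA2]; linear_combination k1
  have j2 : c * B1 + s * B2 = 0 := by rw [hB1, hB2]; linear_combination k2
  have j3 : (2 * mu + lam) * s * A1 - mu * c * A2 - mu * c * B1 + lam * s * B2 = 0 := by
    rw [hA1, hA2, hB1, hB2]
    rcases hn with ⟨rfl, rfl⟩ | ⟨rfl, rfl⟩ <;> push_cast at k3
    · linear_combination k3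
    · linear_combination -k3
  have j4 : -lam * c * A1 + mu * s * A2 + mu * s * B1 - (2 * mu + lam) * c * B2 = 0 := by
    rw [hA1, hA2, hB1, hB2]
    rcases hn with ⟨rfl, rfl⟩ | ⟨rfl, rfl⟩ <;> push_cast at k4
    · linear_combination k4
    · linear_combination -k4
  obtain ⟨P, hP⟩ : ∃ P, P = s * A1 - c * A2 := ⟨_, rfl⟩
  obtain ⟨Q, hQ⟩ : ∃ Q, Q = s * B1 - c * B2 := ⟨_, rfl⟩
  have a1 : A1 = s * P := by rw [hP]; linear_combination c * j1 - A1 * hcs'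
  have a2 : A2 = -c * P := by rw [hP]; linear_combination s * j1 - A2 * hcs'
  have b1 : B1 = s * Q := by rw [hQ]; linear_combination c * j2 - B1 * hcs'
  have b2 : B2 = -c * Q := by rw [hQ]; linear_combination s * j2 - B2 * hcs'
  clear hP hQ
  subst a1 a2 b1 b2
  have hne : ((2 * mu + lam : ℝ) : ℂ) ≠ 0 := by exact_mod_cast (by linarith : (0:ℝ) < _).ne'
  have hme : (mu : ℂ) ≠ 0 := by exact_mod_cast hmu.ne'
  have x1 : ((2 * mu + lam : ℝ) : ℂ) * (s * P - c * Q) = 0 := by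
    push_cast
    linear_combination s * j3 - c * j4 - (2 * mu + lam) * (s * P - c * Q) * hcs'
  have x2 : (mu : ℂ) * (c * P + s * Q) = 0 := by
    linear_combination c * j3 + s * j4 - mu * (c * P + s * Q) * hcs'
  have y1 := (mul_eq_zero.1 x1).resolve_left hne
  have y2 := (mul_eq_zero.1 x2).resolve_left hme
  have hP0 : P = 0 := by linear_combination s * y1 + c * y2 - P * hcs'
  have hQ0 : Q = 0 := by linear_combination -c * y1 + s * y2 - Q * hcs'
  simp [hP0, hQ0]

lemma aux_hess {c s c' s' a b d : ℂ} (hD : c * s' - s * c' ≠ 0)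
    (h : c * a + s * b = 0 ∧ c * b + s * d = 0) (h' : c' * a + s' * b = 0 ∧ c' * b + s' * d = 0) :
    a = 0 ∧ b = 0 ∧ d = 0 := by
  refine ⟨?_, ?_, ?_⟩ <;> apply (mul_eq_zero.1 (?_ : (c * s' - s * c') * _ = 0)).resolve_left hD
  · linear_combination s' * h.1 - s * h'.1
  · linear_combination s' * h.2 - s * h'.2
  · linear_combination c * h'.2 - c' * h.2

lemma aux_sub2 {F G : ℝ × ℝ → ℂ} {O : Set (ℝ × ℝ)} (hO : IsOpen O)
    (hF : ContDiffOn ℝ 2 F O) (hG : ContDiffOn ℝ 2 G O) {x : ℝ × ℝ} (hx : x ∈ O) :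
    pd1 (pd1 fun y => F y - G y) x = pd1 (pd1 F) x - pd1 (pd1 G) x ∧
    pd1 (pd2 fun y => F y - G y) x = pd1 (pd2 F) x - pd1 (pd2 G) x ∧
    pd2 (pd2 fun y => F y - G y) x = pd2 (pd2 F) x - pd2 (pd2 G) x := by
  obtain ⟨f1, f2⟩ := aux_cd (n := 1) hO (by simpa [one_add_one_eq_two] using hF)
  obtain ⟨g1, g2⟩ := aux_cd (n := 1) hO (by simpa [one_add_one_eq_two] using hG)
  have hs : ∀ y ∈ O, _ := fun y hy => aux_sub (aux_diff hO (hF.of_le (by norm_num)) hy)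
    (aux_diff hO (hG.of_le (by norm_num)) hy)
  have s1 := aux_sub (aux_diff hO f1 hx) (aux_diff hO g1 hx)
  have s2 := aux_sub (aux_diff hO f2 hx) (aux_diff hO g2 hx)
  exact ⟨(aux_congr hO (fun y hy => (hs y hy).1) hx).1.trans s1.1,
    (aux_congr hO (fun y hy => (hs y hy).2) hx).1.trans s2.1,
    (aux_congr hO (fun y hy => (hs y hy).2) hx).2.trans s2.2⟩

lemma aux_cont {F : ℝ × ℝ → ℂ} {O : Set (ℝ × ℝ)} (hO : IsOpen O)
    (hF : ContDiffOn ℝ 2 F O) {x : ℝ × ℝ} (hx : x ∈ O) :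
    ContinuousAt (pd1 (pd1 F)) x ∧ ContinuousAt (pd1 (pd2 F)) x ∧
      ContinuousAt (pd2 (pd2 F)) x := by
  obtain ⟨f1, f2⟩ := aux_cd (n := 1) hO (by simpa [one_add_one_eq_two] using hF)
  have a := aux_cd (n := 0) hO (by simpa using f1)
  have b := aux_cd (n := 0) hO (by simpa using f2)
  exact ⟨a.1.continuousOn.continuousAt (hO.mem_nhds hx),
    b.1.continuousOn.continuousAt (hO.mem_nhds hx),
    b.2.continuousOn.continuousAt (hO.mem_nhds hx)⟩

lemma aux_lame_cont (lam mu : ℝ) {u : ℝ × ℝ → ℂ × ℂ} {O : Set (ℝ × ℝ)} (hO : IsOpen O)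
    (hu : ContDiffOn ℝ 2 u O) {x : ℝ × ℝ} (hx : x ∈ O) : ContinuousAt (Lame lam mu u) x := by
  obtain ⟨a1, a2, a3⟩ := aux_cont hO hu.fst hx
  obtain ⟨b1, b2, b3⟩ := aux_cont hO hu.snd hx
  unfold Lame
  fun_prop

lemma aux_closure (θm θM h : ℝ) (h1 : -π < θm) (h2 : θm < θM) (h3 : θM < π) (hh : 0 < h) :
    ((0 : ℝ), (0 : ℝ)) ∈ closure (sector θm θM ∩ disc h) := by
  set t := (θm + θM) / 2 with ht
  have h1' : Tendsto (fun r : ℝ => (r * Real.cos t, r * Real.sin t)) (𝓝[>] 0) (𝓝 (0, 0)) := by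
    have : Continuous fun r : ℝ => (r * Real.cos t, r * Real.sin t) := by fun_prop
    have := this.tendsto 0
    simp only [zero_mul] at this
    exact this.mono_left nhdsWithin_le_nhds
  refine mem_closure_of_tendsto h1' ?_
  filter_upwards [Ioo_mem_nhdsGT hh] with r hr
  have e : ((r * Real.cos t : ℝ) : ℂ) + ((r * Real.sin t : ℝ) : ℂ) * Complex.I
      = (r : ℂ) * (Complex.cos t + Complex.sin t * Complex.I) := by push_cast; ring
  have en : ‖(r : ℂ) * (Complex.cos t + Complex.sin t * Complex.I)‖ = r := by
    rw [norm_mul, Complex.norm_cos_add_sin_mul_I, mul_one, Complex.norm_real,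
      Real.norm_of_nonneg hr.1.le]
  have ea : ((r : ℂ) * (Complex.cos t + Complex.sin t * Complex.I)).arg = t :=
    Complex.arg_mul_cos_add_sin_mul_I hr.1 ⟨by linarith, by linarith⟩
  refine ⟨⟨?_, ?_, ?_⟩, ?_⟩
  · rw [e]; intro h0; rw [h0] at en; simp at en; linarith [hr.1]
  · rw [e, ea]; linarith
  · rw [e, ea]; linarith
  · show ‖_‖ < h
    rw [e, en]; exact hr.2

theorem stmt_15 (lam mu ω α θm θM h : ℝ)
    (hmu : 0 < mu) (hlam : 0 < 2 * lam + 2 * mu) (hω : 0 < ω) (hα : 0 < α) (hα' : α < 1)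
    (h1 : -π < θm) (h2 : θm < θM) (h3 : θM < π) (hangle : θM ≠ θm + π) (hh : 0 < h)
    (V : ℝ × ℝ → ℝ)
    (hV : ∃ C : ℝ, 0 ≤ C ∧ ∀ x ∈ closure (sector θm θM ∩ disc h),
      ∀ y ∈ closure (sector θm θM ∩ disc h),
        |V x - V y| ≤ C * Real.sqrt ((x.1 - y.1) ^ 2 + (x.2 - y.2) ^ 2) ^ α)
    (v w : ℝ × ℝ → ℂ × ℂ) (O : Set (ℝ × ℝ)) (hO : IsOpen O)
    (hsub : closure (sector θm θM ∩ disc h) ⊆ O)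
    (hv : ContDiffOn ℝ 2 v O) (hw : ContDiffOn ℝ 2 w O)
    (heqw : ∀ x ∈ sector θm θM ∩ disc h,
      Lame lam mu w x + ((ω ^ 2 : ℝ) : ℂ) • w x = 0)
    (heqv : ∀ x ∈ sector θm θM ∩ disc h,
      Lame lam mu v x + (((ω ^ 2 : ℝ) : ℂ) * ((1 : ℂ) + (V x : ℂ))) • v x = 0)
    (hbd : ∀ r : ℝ, 0 < r → r < h →
      v (r * Real.cos θm, r * Real.sin θm) = w (r * Real.cos θm, r * Real.sin θm) ∧
      traction lam mu (Real.sin θm, -Real.cos θm) v (r * Real.cos θm, r * Real.sin θm)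
        = traction lam mu (Real.sin θm, -Real.cos θm) w (r * Real.cos θm, r * Real.sin θm) ∧
      v (r * Real.cos θM, r * Real.sin θM) = w (r * Real.cos θM, r * Real.sin θM) ∧
      traction lam mu (-Real.sin θM, Real.cos θM) v (r * Real.cos θM, r * Real.sin θM)
        = traction lam mu (-Real.sin θM, Real.cos θM) w (r * Real.cos θM, r * Real.sin θM))
    (hV0 : V (0, 0) ≠ 0) :
    v (0, 0) = 0 ∧ w (0, 0) = 0 := by
  have hcl := aux_closure θm θM h h1 h2 h3 hh
  have h0 := hsub hcl
  have hv1 : ContDiffOn ℝ 2 (fun y => (v y).1) O := hv.fst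
  have hv2 : ContDiffOn ℝ 2 (fun y => (v y).2) O := hv.snd
  have hw1 : ContDiffOn ℝ 2 (fun y => (w y).1) O := hw.fst
  have hw2 : ContDiffOn ℝ 2 (fun y => (w y).2) O := hw.snd
  have hI : ∀ᶠ r : ℝ in 𝓝[>] 0, r ∈ Ioo 0 h := Ioo_mem_nhdsGT hh
  -- one ray
  have ray : ∀ c s n1 n2 : ℝ, c ^ 2 + s ^ 2 = 1 → (n1 = s ∧ n2 = -c ∨ n1 = -s ∧ n2 = c) →
      (∀ r : ℝ, 0 < r → r < h → v (r * c, r * s) = w (r * c, r * s) ∧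
        traction lam mu (n1, n2) v (r * c, r * s) = traction lam mu (n1, n2) w (r * c, r * s)) →
      _ := fun c s n1 n2 hcs hn hb =>
    aux_one lam mu hmu hlam hO h0 (hv1.sub hw1) (hv2.sub hw2) c s n1 n2 hcs hn
      (by filter_upwards [hI] with r hr
          simp [(hb r hr.1 hr.2).1])
      (by filter_upwards [hI] with r hr
          simp [(hb r hr.1 hr.2).1])
      (by
        filter_upwards [hI, aux_rayO hO h0 c s] with r hr hrO
        have hs1 := aux_sub (aux_diff hO (hv1.of_le (by norm_num)) hrO)
          (aux_diff hO (hw1.of_le (by norm_num)) hrO)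
        have hs2 := aux_sub (aux_diff hO (hv2.of_le (by norm_num)) hrO)
          (aux_diff hO (hw2.of_le (by norm_num)) hrO)
        have ht := (hb r hr.1 hr.2).2
        have t1 := congrArg Prod.fst ht
        have t2 := congrArg Prod.snd ht
        simp only [traction] at t1 t2
        apply Prod.ext
        · simp only [traction, hs1.1, hs1.2, hs2.1, hs2.2, Prod.fst_zero]
          linear_combination t1
        · simp only [traction, hs1.1, hs1.2, hs2.1, hs2.2, Prod.snd_zero]
          linear_combination t2)
  have r1 := ray (Real.cos θm) (Real.sin θm) (Real.sin θm) (-Real.cos θm)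
    (Real.cos_sq_add_sin_sq _) (Or.inl ⟨rfl, rfl⟩)
    fun r hr hr' => ⟨(hbd r hr hr').1, (hbd r hr hr').2.1⟩
  have r2 := ray (Real.cos θM) (Real.sin θM) (-Real.sin θM) (Real.cos θM)
    (Real.cos_sq_add_sin_sq _) (Or.inr ⟨rfl, rfl⟩)
    fun r hr hr' => ⟨(hbd r hr hr').2.2.1, (hbd r hr hr').2.2.2⟩
  have hD : (Real.cos θm : ℂ) * Real.sin θM - Real.sin θm * Real.cos θM ≠ 0 := by
    have e : Real.cos θm * Real.sin θM - Real.sin θm * Real.cos θM = Real.sin (θM - θm) := by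
      rw [Real.sin_sub]; ring
    have : Real.sin (θM - θm) ≠ 0 := by
      intro hs
      rcases lt_or_gt_of_ne hangle with hlt | hgt
      · exact (Real.sin_pos_of_pos_of_lt_pi (by linarith) (by linarith)).ne' hs
      · have : 0 < Real.sin (θM - θm - π) :=
          Real.sin_pos_of_pos_of_lt_pi (by linarith) (by linarith)
        rw [Real.sin_sub_pi] at this
        linarith
    rw [← e] at this
    exact_mod_cast this
  obtain ⟨p1, p2, p3⟩ := aux_hess hD r1.1 r2.1
  obtain ⟨q1, q2, q3⟩ := aux_hess hD r1.2 r2.2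
  have S1 := aux_sub2 hO hv1 hw1 h0
  have S2 := aux_sub2 hO hv2 hw2 h0
  have hL : Lame lam mu v (0, 0) = Lame lam mu w (0, 0) := by
    have x1 := S1.1.symm.trans p1
    have x2 := S1.2.1.symm.trans p2
    have x3 := S1.2.2.symm.trans p3
    have y1 := S2.1.symm.trans q1
    have y2 := S2.2.1.symm.trans q2
    have y3 := S2.2.2.symm.trans q3
    apply Prod.ext
    · simp only [Lame]
      linear_combination lam * (x1 + x3) + (lam + mu) * (x1 + y2)
    · simp only [Lame]
      linear_combination lam * (y1 + y3) + (lam + mu) * (x2 + y3)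
  have hvc : ContinuousAt v (0, 0) := hv.continuousOn.continuousAt (hO.mem_nhds h0)
  have hwc : ContinuousAt w (0, 0) := hw.continuousOn.continuousAt (hO.mem_nhds h0)
  -- v(0) = w(0)
  have hvw : v (0, 0) = w (0, 0) := by
    have z1 := aux_zero (F := fun x => (v x).1 - (w x).1)
      (hvc.fst.sub hwc.fst) (Real.cos θm) (Real.sin θm) (by
        filter_upwards [hI] with r hr
        simp [(hbd r hr.1 hr.2).1])
    have z2 := aux_zero (F := fun x => (v x).2 - (w x).2)
      (hvc.snd.sub hwc.snd) (Real.cos θm) (Real.sin θm) (by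
        filter_upwards [hI] with r hr
        simp [(hbd r hr.1 hr.2).1])
    exact Prod.ext (sub_eq_zero.1 z1) (sub_eq_zero.1 z2)
  -- continuity of V at the corner
  have hVc : Tendsto V (𝓝[sector θm θM ∩ disc h] (0, 0)) (𝓝 (V (0, 0))) := by
    obtain ⟨C, hC, hH⟩ := hV
    rw [tendsto_iff_norm_sub_tendsto_zero]
    have hc : Continuous fun x : ℝ × ℝ =>
        C * Real.sqrt ((x.1 - 0) ^ 2 + (x.2 - 0) ^ 2) ^ α :=
      continuous_const.mul ((by fun_prop : Continuous fun x : ℝ × ℝ =>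
        Real.sqrt ((x.1 - 0) ^ 2 + (x.2 - 0) ^ 2)).rpow_const fun _ => Or.inr hα.le)
    have ht := (hc.tendsto (0, 0)).mono_left
      (nhdsWithin_le_nhds (s := sector θm θM ∩ disc h))
    simp only [sub_zero, ne_eq, OfNat.ofNat_ne_zero, not_false_eq_true, zero_pow, add_zero,
      Real.sqrt_zero, Real.zero_rpow hα.ne', mul_zero] at ht
    refine tendsto_of_tendsto_of_tendsto_of_le_of_le' tendsto_const_nhds ht
      (Eventually.of_forall fun _ => norm_nonneg _) ?_
    filter_upwards [self_mem_nhdsWithin] with x hx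
    simpa using hH x (subset_closure hx) (0, 0) hcl
  haveI : (𝓝[sector θm θM ∩ disc h] ((0 : ℝ), (0 : ℝ))).NeBot :=
    mem_closure_iff_nhdsWithin_neBot.1 hcl
  have lv := (aux_lame_cont lam mu hO hv h0).tendsto.mono_left
    (nhdsWithin_le_nhds (s := sector θm θM ∩ disc h))
  have lw := (aux_lame_cont lam mu hO hw h0).tendsto.mono_left
    (nhdsWithin_le_nhds (s := sector θm θM ∩ disc h))
  have tv := hvc.tendsto.mono_left (nhdsWithin_le_nhds (s := sector θm θM ∩ disc h))
  have tw := hwc.tendsto.mono_left (nhdsWithin_le_nhds (s := sector θm θM ∩ disc h))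
  have tV : Tendsto (fun x => ((ω ^ 2 : ℝ) : ℂ) * ((1 : ℂ) + (V x : ℂ)))
      (𝓝[sector θm θM ∩ disc h] (0, 0)) (𝓝 (((ω ^ 2 : ℝ) : ℂ) * ((1 : ℂ) + (V (0, 0) : ℂ)))) :=
    tendsto_const_nhds.mul (tendsto_const_nhds.add
      ((Complex.continuous_ofReal.tendsto _).comp hVc))
  have E1 := tendsto_nhds_unique (lw.add (tw.const_smul ((ω ^ 2 : ℝ) : ℂ)))
    (tendsto_const_nhds.congr' (by
      filter_upwards [self_mem_nhdsWithin] with x hx using (heqw x hx).symm))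
  have E2 := tendsto_nhds_unique (lv.add (tV.smul tv))
    (tendsto_const_nhds.congr' (by
      filter_upwards [self_mem_nhdsWithin] with x hx using (heqv x hx).symm))
  have E3 : (((ω ^ 2 : ℝ) : ℂ) * (V (0, 0) : ℂ)) • v (0, 0) = 0 := by
    rw [← hL, ← hvw] at E1
    have := congrArg₂ (· - ·) E2 E1
    simp only [sub_zero] at this
    rw [← this]
    module
  have hv0 : v (0, 0) = 0 := by
    refine (smul_eq_zero.1 E3).resolve_left (mul_ne_zero ?_ ?_)
    · exact_mod_cast (pow_pos hω 2).ne'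
    · exact_mod_cast hV0
  exact ⟨hv0, hvw ▸ hv0⟩
end
end

section
/- For every angular frequency ω > 0 there exist Lamé constants λ, μ ∈ ℝ satisfying the strong convexity condition μ > 0 and 3λ + 2μ > 0 (so in particular λ + 2μ > 0) such that, with the shear and compressional wavenumbers ω_s = ω/√μ and ω_p = ω/√(λ+2μ), one has for every unit vector e ∈ ℝ³: ∫_{B(0,1)} exp(−i·ω_s·⟨e, y⟩) dy = 0 and ∫_{B(0,1)} exp(−i·ω_p·⟨e, y⟩) dy = 0. Consequently the nonzero source f = e₁·χ_{B(0,1)} radiates zero transversal and longitudinal elastic far fields u_s^∞ and u_p^∞ in all directions. -/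
noncomputable section

open Complex MeasureTheory Real





lemma ex_root (a : ℝ) (b : ℝ) (hab : a ≤ b) (h : (Real.sin a - a * Real.cos a) * (Real.sin b - b * Real.cos b) ≤ 0) :
    ∃ k ∈ Set.Icc a b, Real.sin k - k * Real.cos k = 0 := by
  have hc : ContinuousOn (fun k => Real.sin k - k * Real.cos k) (Set.Icc a b) := by fun_prop
  rcases mul_nonpos_iff.1 h with h | h
  · have := intermediate_value_Icc' hab hc ⟨h.2, h.1⟩
    obtain ⟨k, hk, h⟩ := this; exact ⟨k, hk, h⟩
  · have := intermediate_value_Icc hab hc ⟨h.1, h.2⟩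
    obtain ⟨k, hk, h⟩ := this; exact ⟨k, hk, h⟩

lemma root1 : ∃ k ∈ Set.Icc π (3 * π / 2), Real.sin k - k * Real.cos k = 0 := by
  apply ex_root
  · linarith [Real.pi_pos]
  · have h : 3 * π / 2 = π / 2 + π := by ring
    rw [h, Real.sin_add_pi, Real.cos_add_pi]; simp [Real.pi_pos.le]

lemma root2 : ∃ k ∈ Set.Icc (2 * π) (5 * π / 2), Real.sin k - k * Real.cos k = 0 := by
  apply ex_root
  · linarith [Real.pi_pos]
  · have h : 5 * π / 2 = π / 2 + 2 * π := by ring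
    rw [h, Real.sin_add_two_pi, Real.cos_add_two_pi]; simp [Real.pi_pos.le]

lemma one_dim (k : ℝ) (hk : k ≠ 0) (h : Real.sin k - k * Real.cos k = 0) :
    ∫ t in (-1:ℝ)..1, ((π * (1 - t^2) : ℝ) : ℂ) * Complex.exp (-Complex.I * (k : ℂ) * (t : ℂ)) = 0 := by
  have hkc : (k : ℂ) ≠ 0 := by exact_mod_cast hk
  have hI := Complex.I_ne_zero
  -- antiderivative
  let F : ℝ → ℂ := fun t => π * (Complex.I * (1 - (t:ℂ)^2) / k - 2 * t / k^2 + 2 * Complex.I / k^3) *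
    Complex.exp (-Complex.I * (k : ℂ) * (t : ℂ))
  have hd : ∀ t : ℝ, HasDerivAt F (((π * (1 - t^2) : ℝ) : ℂ) * Complex.exp (-Complex.I * (k : ℂ) * (t : ℂ))) t := by
    intro t
    have h0 : HasDerivAt (fun z : ℂ => π * (Complex.I * (1 - z^2) / k - 2 * z / k^2 + 2 * Complex.I / k^3) *
       Complex.exp (-Complex.I * (k : ℂ) * z)) (((π * (1 - t^2) : ℝ) : ℂ) * Complex.exp (-Complex.I * (k : ℂ) * (t : ℂ))) (t:ℂ) := by
      have hid := hasDerivAt_id (t:ℂ)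
      have h1 := (((((((hid.pow 2).const_sub 1).const_mul Complex.I).div_const (k:ℂ)).sub
        ((hid.const_mul 2).div_const ((k:ℂ)^2))).add_const (2 * Complex.I / (k:ℂ)^3)).const_mul (π:ℂ)).mul
        ((hid.const_mul (-Complex.I * (k : ℂ))).cexp)
      refine h1.congr_deriv ?_
      simp only [id, Pi.pow_apply, Pi.sub_apply]
      push_cast
      generalize Complex.exp (-Complex.I * (k : ℂ) * (t : ℂ)) = E
      field_simp
      ring_nf
      simp only [Complex.I_sq]
      ring
    exact h0.comp_ofReal
  rw [intervalIntegral.integral_eq_sub_of_hasDerivAt (fun t _ => hd t)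
    (Continuous.intervalIntegrable (by fun_prop) _ _)]
  simp only [F]
  have e1 : Complex.exp (-Complex.I * (k : ℂ) * ((1:ℝ) : ℂ)) = Complex.cos k - Complex.sin k * Complex.I := by
    rw [show -Complex.I * (k : ℂ) * ((1:ℝ) : ℂ) = (-k : ℂ) * Complex.I by push_cast; ring,
      Complex.exp_mul_I, Complex.cos_neg, Complex.sin_neg]; ring
  have e2 : Complex.exp (-Complex.I * (k : ℂ) * ((-1:ℝ) : ℂ)) = Complex.cos k + Complex.sin k * Complex.I := by
    rw [← Complex.exp_mul_I]; congr 1; push_cast; ring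
  have hs : Complex.sin k = k * Complex.cos k := by
    have : Real.sin k = k * Real.cos k := by linarith
    exact_mod_cast congrArg Complex.ofReal this
  rw [e1, e2, hs]
  push_cast
  field_simp
  ring_nf
  simp only [Complex.I_sq]
  ring

lemma disc_s17 (r : ℝ) : volume.real {z : Fin 2 → ℝ | z 0 ^ 2 + z 1 ^ 2 < r} = π * max r 0 := by
  have hm := (PiLp.volume_preserving_ofLp (Fin 2))
  have hS : MeasurableSet {z : Fin 2 → ℝ | z 0 ^ 2 + z 1 ^ 2 < r} :=
    measurableSet_lt (by fun_prop) (by fun_prop)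
  rcases le_or_gt r 0 with hr | hr
  · have : {z : Fin 2 → ℝ | z 0 ^ 2 + z 1 ^ 2 < r} = ∅ := by
      ext z; simp; nlinarith [sq_nonneg (z 0), sq_nonneg (z 1)]
    rw [this, max_eq_right hr]; simp
  · rw [measureReal_def, ← hm.measure_preimage hS.nullMeasurableSet]
    have : WithLp.ofLp ⁻¹' {z : Fin 2 → ℝ | z 0 ^ 2 + z 1 ^ 2 < r} = Metric.ball (0 : EuclideanSpace ℝ (Fin 2)) (√r) := by
      rw [EuclideanSpace.ball_zero_eq _ (Real.sqrt_nonneg _)]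
      ext z; simp [Fin.sum_univ_two, Real.sq_sqrt hr.le]
    rw [this, EuclideanSpace.volume_ball_fin_two, max_eq_left hr.le, ← ENNReal.ofReal_pow (by positivity), Real.sq_sqrt hr.le]
    simp [hr.le, mul_comm, Real.pi_pos.le]

lemma prod_int (k : ℝ) (hk : k ≠ 0) (h : Real.sin k - k * Real.cos k = 0) :
    ∫ p in {p : ℝ × (Fin 2 → ℝ) | p.1 ^ 2 + (p.2 0 ^ 2 + p.2 1 ^ 2) < 1},
      Complex.exp (-Complex.I * (k : ℂ) * (p.1 : ℂ)) = 0 := by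
  set S : Set (ℝ × (Fin 2 → ℝ)) := {p | p.1 ^ 2 + (p.2 0 ^ 2 + p.2 1 ^ 2) < 1} with hSdef
  have hS : MeasurableSet S := measurableSet_lt (by fun_prop) (by fun_prop)
  have hsub : S ⊆ (Set.Icc (-1) 1) ×ˢ (Set.Icc (fun _ => -1) (fun _ => 1)) := by
    intro p hp
    simp only [hSdef, Set.mem_ofPred_eq] at hp
    simp only [Set.mem_prod, Set.mem_Icc, Pi.le_def, Fin.forall_fin_two]
    refine ⟨⟨?_, ?_⟩, ⟨?_, ?_⟩, ?_, ?_⟩ <;>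
      nlinarith [sq_nonneg (p.1), sq_nonneg (p.2 0), sq_nonneg (p.2 1)]
  have hint : IntegrableOn (fun p : ℝ × (Fin 2 → ℝ) => Complex.exp (-Complex.I * (k : ℂ) * (p.1 : ℂ))) S := by
    refine IntegrableOn.mono_set ?_ hsub
    exact ContinuousOn.integrableOn_compact (isCompact_Icc.prod isCompact_Icc) (by fun_prop)
  rw [← integral_indicator hS, Measure.volume_eq_prod, integral_prod]
  · have hin : ∀ t : ℝ, (∫ z : Fin 2 → ℝ, S.indicator
        (fun p : ℝ × (Fin 2 → ℝ) => Complex.exp (-Complex.I * (k : ℂ) * (p.1 : ℂ))) (t, z)) =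
        (Set.Ioc (-1:ℝ) 1).indicator (fun t => ((π * (1 - t^2) : ℝ) : ℂ) * Complex.exp (-Complex.I * (k : ℂ) * (t : ℂ))) t := by
      intro t
      have hS2 : MeasurableSet {z : Fin 2 → ℝ | z 0 ^ 2 + z 1 ^ 2 < 1 - t ^ 2} :=
        measurableSet_lt (by fun_prop) (by fun_prop)
      have : (fun z : Fin 2 → ℝ => S.indicator
        (fun p : ℝ × (Fin 2 → ℝ) => Complex.exp (-Complex.I * (k : ℂ) * (p.1 : ℂ))) (t, z)) =
        {z : Fin 2 → ℝ | z 0 ^ 2 + z 1 ^ 2 < 1 - t ^ 2}.indicator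
          (fun _ => Complex.exp (-Complex.I * (k : ℂ) * (t : ℂ))) := by
        ext z
        simp only [Set.indicator_apply, hSdef, Set.mem_ofPred_eq]
        congr 1
        exact propext ⟨fun h => by linarith, fun h => by linarith⟩
      rw [this, integral_indicator hS2, setIntegral_const, disc_s17]
      by_cases ht : t ∈ Set.Ioc (-1:ℝ) 1
      · rw [Set.indicator_of_mem ht, max_eq_left (by nlinarith [ht.1, ht.2])]
        simp
      · rw [Set.indicator_of_notMem ht, max_eq_right]
        · simp
        · by_contra hc
          apply ht
          constructor <;> nlinarith
    simp_rw [hin]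
    rw [integral_indicator measurableSet_Ioc, ← intervalIntegral.integral_of_le (by norm_num)]
    exact one_dim k hk h
  · rw [← Measure.volume_eq_prod]
    exact (integrable_indicator_iff hS).2 hint

lemma ball_int (k : ℝ) (hk : k ≠ 0) (h : Real.sin k - k * Real.cos k = 0)
    (e : EuclideanSpace ℝ (Fin 3)) (he : ‖e‖ = 1) :
    ∫ y in Metric.ball (0 : EuclideanSpace ℝ (Fin 3)) 1,
      Complex.exp (-Complex.I * (k : ℂ) * (Complex.ofReal (inner ℝ e y))) = 0 := by
  obtain ⟨b, hb⟩ := Orthonormal.exists_orthonormalBasis_extension_of_card_eq (𝕜 := ℝ)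
    (E := EuclideanSpace ℝ (Fin 3)) (ι := Fin 3) (by simp) (v := fun _ => e) (s := {0}) (by
      constructor
      · intro i; simpa using he
      · intro i j hij; exact absurd (Subsingleton.elim i j) hij)
  have hb0 : b 0 = e := hb 0 rfl
  let T := (b.measurableEquiv.trans (MeasurableEquiv.toLp 2 (Fin 3 → ℝ)).symm).trans
    (MeasurableEquiv.piFinSuccAbove (fun _ : Fin 3 => ℝ) 0)
  have hT : MeasurePreserving T volume volume :=
    (volume_preserving_piFinSuccAbove (fun _ : Fin 3 => ℝ) 0).comp
      ((PiLp.volume_preserving_ofLp (Fin 3)).comp b.measurePreserving_measurableEquiv)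
  have hT1 : ∀ y, (T y).1 = inner ℝ e y := by
    intro y
    rw [← hb0, ← b.repr_apply_apply]; rfl
  have hT2 : ∀ y, (T y).1 ^ 2 + ((T y).2 0 ^ 2 + (T y).2 1 ^ 2) = ‖y‖ ^ 2 := by
    intro y
    rw [← b.repr.norm_map y, EuclideanSpace.norm_sq_eq, Fin.sum_univ_three]
    simp only [Real.norm_eq_abs, sq_abs, add_assoc]
    rfl
  have key := hT.setIntegral_preimage_emb T.measurableEmbedding
    (fun p => Complex.exp (-Complex.I * (k : ℂ) * (p.1 : ℂ)))
    {p : ℝ × (Fin 2 → ℝ) | p.1 ^ 2 + (p.2 0 ^ 2 + p.2 1 ^ 2) < 1}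
  rw [prod_int k hk h] at key
  have hpre : T ⁻¹' {p : ℝ × (Fin 2 → ℝ) | p.1 ^ 2 + (p.2 0 ^ 2 + p.2 1 ^ 2) < 1} =
      Metric.ball (0 : EuclideanSpace ℝ (Fin 3)) 1 := by
    ext y
    simp only [Set.mem_preimage, Set.mem_ofPred_eq, hT2, mem_ball_zero_iff]
    exact sq_lt_one_iff₀ (norm_nonneg y)
  rw [hpre] at key
  simpa only [hT1] using key

theorem stmt_17 (ω : ℝ) (hω : 0 < ω) :
    ∃ lam mu : ℝ, 0 < mu ∧ 0 < 3 * lam + 2 * mu ∧ 0 < lam + 2 * mu ∧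
      ∀ e : EuclideanSpace ℝ (Fin 3), ‖e‖ = 1 →
        (∫ y in Metric.ball (0 : EuclideanSpace ℝ (Fin 3)) 1,
            Complex.exp (-Complex.I * ((ω / Real.sqrt mu : ℝ) : ℂ) *
              (Complex.ofReal (inner ℝ e y))) = 0) ∧
        (∫ y in Metric.ball (0 : EuclideanSpace ℝ (Fin 3)) 1,
            Complex.exp (-Complex.I * ((ω / Real.sqrt (lam + 2 * mu) : ℝ) : ℂ) *
              (Complex.ofReal (inner ℝ e y))) = 0) := by
  obtain ⟨p, ⟨hp1, hp2⟩, hp⟩ := root1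
  obtain ⟨s, ⟨hs1, hs2⟩, hs⟩ := root2
  have hpi := Real.pi_pos
  have hp0 : 0 < p := by linarith
  have hs0 : 0 < s := by linarith
  have hsq : ∀ k : ℝ, 0 < k → ω / √((ω / k) ^ 2) = k := by
    intro k hk
    rw [Real.sqrt_sq (by positivity)]
    field_simp
  have hm : 0 < (ω / s) ^ 2 := by positivity
  have hle : 4 / 3 * (ω / s) ≤ ω / p := by
    rw [← mul_div_assoc, div_le_div_iff₀ hs0 hp0]
    nlinarith
  have hq : 0 < ω / s := by positivity
  refine ⟨(ω / p) ^ 2 - 2 * (ω / s) ^ 2, (ω / s) ^ 2, hm, by nlinarith, ?_, ?_⟩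
  · rw [sub_add_cancel]; positivity
  · intro e he
    rw [sub_add_cancel, hsq s hs0, hsq p hp0]
    exact ⟨ball_int s hs0.ne' hs e he, ball_int p hp0.ne' hp e he⟩
end
end
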